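/- arXiv:1708.01279 — 2 statements merged into one kernel-verified Lean document; each statement's English description precedes it below -/
import Mathlib

section
/- Simple broom lemma: Let G be a simple edge-Δ-critical graph, e₁ = y₀y₁ ∈ E(G), φ ∈ C^Δ(G - e₁), and let B = (y₀, e₁, y₁, e₂, y₂, e₃, y₃, ..., e_p, y_p) be a simple broom, i.e., e₂ = y₁y₂, e_i = y₂y_i for i ≥ 3, and φ(e_i) ∈ φ̄(y₀) ∪ φ̄(y₁) for each i ≥ 2. If |φ̄(y₀) ∪ φ̄(y₁)| ≥ 4 and min{d(y₁), d(y₂)} < Δ, then V(B) is elementary with respect to φ. -/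
open Finset
open scoped Classical

variable {V : Type*}

/-- `φ` is a proper edge coloring of `G` using colors `{1,…,k}`. -/
def IsProperEdgeColoring (G : SimpleGraph V) (k : ℕ) (φ : Sym2 V → ℕ) : Prop :=
  (∀ e ∈ G.edgeSet, φ e ∈ Finset.Icc 1 k) ∧
  ∀ e ∈ G.edgeSet, ∀ f ∈ G.edgeSet, e ≠ f → (∃ v, v ∈ e ∧ v ∈ f) → φ e ≠ φ f

/-- The set of colors of `{1,…,k}` missing at `v` under `φ`. -/
noncomputable def missing (G : SimpleGraph V) (k : ℕ) (φ : Sym2 V → ℕ) (v : V) : Finset ℕ :=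
  (Finset.Icc 1 k).filter (fun c => ∀ u, G.Adj v u → φ s(v, u) ≠ c)

/-- `G` is edge-`Δ`-critical: max degree `Δ`, `χ' = Δ+1`, and every proper
subgraph is edge-`Δ`-colorable. -/
def EdgeCritical (G : SimpleGraph V) [Fintype V] (Δ : ℕ) : Prop :=
  G.maxDegree = Δ ∧
  ¬ (∃ φ, IsProperEdgeColoring G Δ φ) ∧
  (∃ φ, IsProperEdgeColoring G (Δ + 1) φ) ∧
  ∀ H : SimpleGraph V, H < G → ∃ φ, IsProperEdgeColoring H Δ φ

/-- Missing colors in `G - y₀y₁`. -/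
noncomputable def m6 (G : SimpleGraph V) (Δ : ℕ) (φ : Sym2 V → ℕ) (y0 y1 v : V) : Finset ℕ :=
  missing (G.deleteEdges {s(y0, y1)}) Δ φ v

theorem mem_missing {G : SimpleGraph V} {k : ℕ} {φ : Sym2 V → ℕ} {v : V} {c : ℕ} :
    c ∈ missing G k φ v ↔ c ∈ Finset.Icc 1 k ∧ ∀ u, G.Adj v u → φ s(v, u) ≠ c := by
  simp [missing]

theorem mem_m6 {G : SimpleGraph V} {Δ : ℕ} {φ : Sym2 V → ℕ} {x y v : V} {c : ℕ} :
    c ∈ m6 G Δ φ x y v ↔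
      c ∈ Finset.Icc 1 Δ ∧ ∀ u, G.Adj v u → s(v, u) ≠ s(x, y) → φ s(v, u) ≠ c := by
  simp [m6, mem_missing]

theorem IsProperEdgeColoring.ne {H : SimpleGraph V} {k : ℕ} {φ : Sym2 V → ℕ}
    (hφ : IsProperEdgeColoring H k φ) {v u w : V} (hu : H.Adj v u) (hw : H.Adj v w)
    (huw : u ≠ w) : φ s(v, u) ≠ φ s(v, w) := by
  refine hφ.2 _ hu _ hw ?_ ⟨v, by simp, by simp⟩
  exact fun h => huw (Sym2.congr_right.1 h)

theorem IsProperEdgeColoring.of_ne {H : SimpleGraph V} {k : ℕ} {φ : Sym2 V → ℕ}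
    (h1 : ∀ v u, H.Adj v u → φ s(v, u) ∈ Finset.Icc 1 k)
    (h2 : ∀ v u w, H.Adj v u → H.Adj v w → u ≠ w → φ s(v, u) ≠ φ s(v, w)) :
    IsProperEdgeColoring H k φ := by
  constructor
  · intro e he
    induction e with
    | h a b => exact h1 a b he
  · rintro e he f hf hef ⟨v, hve, hvf⟩
    obtain ⟨u, rfl⟩ := hve
    obtain ⟨w, rfl⟩ := hvf
    exact h2 v u w he hf (by rintro rfl; exact hef rfl)

/-- Colour the edge `xy` with a colour that no other edge at `x` or `y` uses. -/
theorem IsProperEdgeColoring.update {H H' : SimpleGraph V} {k : ℕ} {φ : Sym2 V → ℕ} {x y : V}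
    {c : ℕ} (hφ : IsProperEdgeColoring H k φ)
    (hsub : ∀ u w, H'.Adj u w → s(u, w) ≠ s(x, y) → H.Adj u w)
    (hck : c ∈ Finset.Icc 1 k)
    (hx : ∀ u, H'.Adj x u → s(x, u) ≠ s(x, y) → φ s(x, u) ≠ c)
    (hy : ∀ u, H'.Adj y u → s(y, u) ≠ s(x, y) → φ s(y, u) ≠ c) :
    IsProperEdgeColoring H' k (Function.update φ s(x, y) c) := by
  have key : ∀ v u w, H'.Adj v w → s(v, u) = s(x, y) → s(v, w) ≠ s(x, y) → φ s(v, w) ≠ c := by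
    intro v u w hw hu hne
    have hv : v = x ∨ v = y := by
      have : v ∈ s(x, y) := hu ▸ Sym2.mem_mk_left v u
      simpa using this
    rcases hv with rfl | rfl
    · exact hx w hw hne
    · exact hy w hw hne
  apply IsProperEdgeColoring.of_ne
  · intro v u hvu
    by_cases h : s(v, u) = s(x, y)
    · rwa [h, Function.update_self]
    · rw [Function.update_of_ne h]
      exact hφ.1 _ (hsub v u hvu h)
  · intro v u w hu hw huw
    by_cases h : s(v, u) = s(x, y) <;> by_cases h' : s(v, w) = s(x, y)
    · exact absurd (Sym2.congr_right.1 (h.trans h'.symm)) huw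
    · rw [h, Function.update_self, Function.update_of_ne h']
      exact (key v u w hw h h').symm
    · rw [h', Function.update_self, Function.update_of_ne h]
      exact key v w u hu h' h
    · rw [Function.update_of_ne h, Function.update_of_ne h']
      exact hφ.ne (hsub _ _ hu h) (hsub _ _ hw h') huw

/-- The subgraph of the edges coloured `α` or `β`. -/
def kempe (H : SimpleGraph V) (φ : Sym2 V → ℕ) (α β : ℕ) : SimpleGraph V where
  Adj u w := H.Adj u w ∧ (φ s(u, w) = α ∨ φ s(u, w) = β)
  symm := ⟨fun u w h => by rw [Sym2.eq_swap]; exact ⟨h.1.symm, h.2⟩⟩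
  loopless := ⟨fun u h => H.loopless.irrefl u h.1⟩

theorem kempe_comm (H : SimpleGraph V) (φ : Sym2 V → ℕ) (α β : ℕ) :
    kempe H φ α β = kempe H φ β α := by
  ext u w
  simp [kempe, or_comm]

/-- Interchanging `α` and `β` on the Kempe chain through `v`. -/
theorem IsProperEdgeColoring.exists_swap {H : SimpleGraph V} {k : ℕ} {φ : Sym2 V → ℕ} {α β : ℕ}
    (hφ : IsProperEdgeColoring H k φ) (hα : α ∈ Finset.Icc 1 k) (hβ : β ∈ Finset.Icc 1 k)
    (v : V) :
    ∃ ψ, IsProperEdgeColoring H k ψ ∧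
      (∀ u, (kempe H φ α β).Reachable v u →
        (α ∈ missing H k ψ u ↔ β ∈ missing H k φ u) ∧
        (β ∈ missing H k ψ u ↔ α ∈ missing H k φ u)) ∧
      (∀ u, ¬ (kempe H φ α β).Reachable v u → missing H k ψ u = missing H k φ u) ∧
      (∀ u c, c ≠ α → c ≠ β → (c ∈ missing H k ψ u ↔ c ∈ missing H k φ u)) ∧
      (∀ u w, H.Adj u w →
        (φ s(u, w) ≠ α ∧ φ s(u, w) ≠ β) ∨ ¬ (kempe H φ α β).Reachable v u →
          ψ s(u, w) = φ s(u, w)) := by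
  set K := kempe H φ α β with hK
  let ψ : Sym2 V → ℕ := fun e =>
    if ∃ u ∈ e, K.Reachable v u then Equiv.swap α β (φ e) else φ e
  have hin : ∀ u w, K.Reachable v u → ψ s(u, w) = Equiv.swap α β (φ s(u, w)) := by
    intro u w hu
    have : ∃ a ∈ s(u, w), K.Reachable v a := ⟨u, by simp, hu⟩
    simp only [ψ, if_pos this]
  have hout : ∀ u w, H.Adj u w → ¬ K.Reachable v u → ψ s(u, w) = φ s(u, w) := by
    intro u w huw hu
    by_cases hw : K.Reachable v w
    · rw [Sym2.eq_swap, hin w u hw]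
      have h1 : ¬ (φ s(w, u) = α ∨ φ s(w, u) = β) := fun h =>
        hu (hw.trans (SimpleGraph.Adj.reachable ⟨huw.symm, h⟩))
      rw [not_or] at h1
      exact Equiv.swap_apply_of_ne_of_ne h1.1 h1.2
    · have : ¬ ∃ a ∈ s(u, w), K.Reachable v a := by simp [hu, hw]
      simp only [ψ, if_neg this]
  have hswap : ∀ c ∈ Finset.Icc 1 k, Equiv.swap α β c ∈ Finset.Icc 1 k := by
    intro c hc
    rw [Equiv.swap_apply_def]
    split_ifs <;> assumption
  have hmin : ∀ u c, K.Reachable v u →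
      (c ∈ missing H k ψ u ↔ Equiv.swap α β c ∈ missing H k φ u) := by
    intro u c hu
    rw [mem_missing, mem_missing]
    refine and_congr ⟨hswap c, fun h => by simpa using hswap _ h⟩ ?_
    refine forall_congr' fun w => forall_congr' fun hw => ?_
    rw [hin u w hu, ne_eq, ne_eq, Equiv.swap_apply_eq_iff]
  have hmout : ∀ u, ¬ K.Reachable v u → missing H k ψ u = missing H k φ u := by
    intro u hu
    ext c
    rw [mem_missing, mem_missing]
    refine and_congr Iff.rfl (forall_congr' fun w => forall_congr' fun hw => ?_)
    rw [hout u w hw hu]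
  refine ⟨ψ, IsProperEdgeColoring.of_ne ?_ ?_, ?_, hmout, ?_, ?_⟩
  · intro u w huw
    have h := hφ.1 s(u, w) huw
    by_cases hu : K.Reachable v u
    · rw [hin u w hu]
      exact hswap _ h
    · rwa [hout u w huw hu]
  · intro u w z hw hz hwz
    by_cases hu : K.Reachable v u
    · rw [hin u w hu, hin u z hu]
      exact fun h => hφ.ne hw hz hwz ((Equiv.swap α β).injective h)
    · rw [hout u w hw hu, hout u z hz hu]
      exact hφ.ne hw hz hwz
  · intro u hu
    rw [hmin u _ hu, hmin u _ hu, Equiv.swap_apply_left, Equiv.swap_apply_right]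
    exact ⟨Iff.rfl, Iff.rfl⟩
  · intro u c h1 h2
    by_cases hu : K.Reachable v u
    · rw [hmin u c hu, Equiv.swap_apply_of_ne_of_ne h1 h2]
    · rw [hmout u hu]
  · intro u w huw h
    by_cases hu : K.Reachable v u
    · rw [hin u w hu]
      rcases h with h | h
      · exact Equiv.swap_apply_of_ne_of_ne h.1 h.2
      · exact absurd hu h
    · exact hout u w huw hu

/-- A component of a graph of maximum degree two has at most two vertices of degree one. -/
theorem not_reachable_three_ends [Fintype V] (K : SimpleGraph V) (h2 : ∀ v, K.degree v ≤ 2)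
    {x y z : V} (hxy : x ≠ y) (hxz : x ≠ z) (hyz : y ≠ z) (hx : K.degree x ≤ 1)
    (hy : K.degree y ≤ 1) (hz : K.degree z ≤ 1) (rxy : K.Reachable x y)
    (rxz : K.Reachable x z) : False := by
  let C := K.connectedComponentMk x
  have hconn : (K.induce C.supp).Connected := C.connected_toSimpleGraph
  have hcard := hconn.card_vert_le_card_edgeSet_add_one
  have hsum := (K.induce C.supp).sum_degrees_eq_twice_card_edges
  have hdeg : ∀ v : C.supp, (K.induce C.supp).degree v ≤ K.degree v := by
    intro v
    rw [← SimpleGraph.card_neighborFinset_eq_degree, ← SimpleGraph.card_neighborFinset_eq_degree]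
    refine Finset.card_le_card_of_injOn Subtype.val ?_ Subtype.val_injective.injOn
    intro w hw
    simpa using hw
  have hyC : y ∈ C.supp := SimpleGraph.ConnectedComponent.sound rxy.symm
  have hzC : z ∈ C.supp := SimpleGraph.ConnectedComponent.sound rxz.symm
  have hxC : x ∈ C.supp := rfl
  let T : Finset C.supp := {⟨x, hxC⟩, ⟨y, hyC⟩, ⟨z, hzC⟩}
  have hT : T.card = 3 := Finset.card_eq_three.2
    ⟨_, _, _, by simpa using hxy, by simpa using hxz, by simpa using hyz, rfl⟩
  have hle : ∀ v : C.supp, (K.induce C.supp).degree v + (if v ∈ T then 1 else 0) ≤ 2 := by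
    intro v
    have hv := hdeg v
    split_ifs with h
    · simp only [T, Finset.mem_insert, Finset.mem_singleton] at h
      rcases h with rfl | rfl | rfl
      · exact Nat.succ_le_succ (hv.trans hx)
      · exact Nat.succ_le_succ (hv.trans hy)
      · exact Nat.succ_le_succ (hv.trans hz)
    · exact hv.trans (h2 v)
  have htot := Finset.sum_le_sum (s := Finset.univ) fun v _ => hle v
  rw [Finset.sum_add_distrib, hsum, Finset.sum_ite_mem, Finset.univ_inter, Finset.sum_const,
    Finset.sum_const, hT, Finset.card_univ, smul_eq_mul, smul_eq_mul] at htot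
  rw [Nat.card_eq_fintype_card, Nat.card_eq_fintype_card,
    ← SimpleGraph.edgeFinset_card] at hcard
  omega

theorem IsProperEdgeColoring.kempe_degree_le [Fintype V] {H : SimpleGraph V} {k : ℕ}
    {φ : Sym2 V → ℕ} (hφ : IsProperEdgeColoring H k φ) (α β : ℕ) (v : V) (S : Finset ℕ)
    (hS : ∀ u, H.Adj v u → (φ s(v, u) = α ∨ φ s(v, u) = β) → φ s(v, u) ∈ S) :
    (kempe H φ α β).degree v ≤ S.card := by
  rw [← SimpleGraph.card_neighborFinset_eq_degree]
  refine Finset.card_le_card_of_injOn (fun u => φ s(v, u)) ?_ ?_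
  · intro u hu
    have h : (kempe H φ α β).Adj v u := by simpa using hu
    exact hS u h.1 h.2
  · intro u hu w hw huw
    have h : (kempe H φ α β).Adj v u := by simpa using hu
    have h' : (kempe H φ α β).Adj v w := by simpa using hw
    by_contra hne
    exact hφ.ne h.1 h'.1 hne huw

/-- At most two vertices of a Kempe chain miss one of its two colours. -/
theorem IsProperEdgeColoring.not_three_ends [Fintype V] {H : SimpleGraph V} {k : ℕ}
    {φ : Sym2 V → ℕ} (hφ : IsProperEdgeColoring H k φ) {α β : ℕ} {x y z : V}
    (hxy : x ≠ y) (hxz : x ≠ z) (hyz : y ≠ z)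
    (hx : α ∈ missing H k φ x ∨ β ∈ missing H k φ x)
    (hy : α ∈ missing H k φ y ∨ β ∈ missing H k φ y)
    (hz : α ∈ missing H k φ z ∨ β ∈ missing H k φ z)
    (rxy : (kempe H φ α β).Reachable x y) (rxz : (kempe H φ α β).Reachable x z) : False := by
  have h1 : ∀ v, (α ∈ missing H k φ v ∨ β ∈ missing H k φ v) →
      (kempe H φ α β).degree v ≤ 1 := by
    rintro v (h | h)
    · refine hφ.kempe_degree_le α β v {β} fun u hu hc => ?_
      have := (mem_missing.1 h).2 u hu
      simp only [Finset.mem_singleton]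
      tauto
    · refine hφ.kempe_degree_le α β v {α} fun u hu hc => ?_
      have := (mem_missing.1 h).2 u hu
      simp only [Finset.mem_singleton]
      tauto
  refine not_reachable_three_ends _ (fun v => ?_) hxy hxz hyz (h1 x hx) (h1 y hy) (h1 z hz)
    rxy rxz
  refine (hφ.kempe_degree_le α β v {α, β} fun u _ hc => ?_).trans Finset.card_le_two
  simpa using hc

section Fan

variable {G : SimpleGraph V} {Δ : ℕ} {φ : Sym2 V → ℕ}

theorem adj_deleteEdge {x y u w : V} (h : G.Adj u w) (hne : s(u, w) ≠ s(x, y)) :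
    (G.deleteEdges {s(x, y)}).Adj u w := by
  simpa [SimpleGraph.deleteEdges_adj, h] using hne

theorem ends_disjoint (hG : ¬ ∃ ψ, IsProperEdgeColoring G Δ ψ) {y x : V}
    (hφ : IsProperEdgeColoring (G.deleteEdges {s(y, x)}) Δ φ) {c : ℕ}
    (hy : c ∈ m6 G Δ φ y x y) (hx : c ∈ m6 G Δ φ y x x) : False := by
  rw [mem_m6] at hx hy
  exact hG ⟨_, hφ.update (fun u w h hne => adj_deleteEdge h hne) hx.1 hy.2 hx.2⟩

theorem ends_linked (hG : ¬ ∃ ψ, IsProperEdgeColoring G Δ ψ) {y x : V}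
    (hφ : IsProperEdgeColoring (G.deleteEdges {s(y, x)}) Δ φ) {α β : ℕ}
    (hy : α ∈ m6 G Δ φ y x y) (hx : β ∈ m6 G Δ φ y x x) :
    (kempe (G.deleteEdges {s(y, x)}) φ α β).Reachable y x := by
  by_contra hr
  obtain ⟨ψ, hψ, h1, h2, -, -⟩ := hφ.exists_swap (mem_m6.1 hy).1 (mem_m6.1 hx).1 y
  refine ends_disjoint hG hψ (c := β) ((h1 y (SimpleGraph.Reachable.refl y)).2.2 hy) ?_
  rw [m6, h2 x hr]
  exact hx

theorem color_ne_of_mem_m6 {x y u w : V} {c : ℕ} (huw : G.Adj u w) (hne : s(u, w) ≠ s(x, y))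
    (hc : c ∈ m6 G Δ φ x y u) : φ s(u, w) ≠ c :=
  (mem_m6.1 hc).2 w huw hne

theorem color_ne_of_mem_m6' {x y u w : V} {c : ℕ} (huw : G.Adj u w) (hne : s(u, w) ≠ s(x, y))
    (hc : c ∈ m6 G Δ φ x y w) : φ s(u, w) ≠ c := by
  rw [Sym2.eq_swap] at hne ⊢
  exact color_ne_of_mem_m6 huw.symm hne hc

/-- Move the uncoloured edge from `yx` to `xz`. -/
theorem shift_proper {y x z : V} (hφ : IsProperEdgeColoring (G.deleteEdges {s(y, x)}) Δ φ)
    (hxz : G.Adj x z) (hyz : y ≠ z) (ha : φ s(x, z) ∈ m6 G Δ φ y x y) :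
    IsProperEdgeColoring (G.deleteEdges {s(x, z)}) Δ
      (Function.update φ s(y, x) (φ s(x, z))) := by
  have ha' := mem_m6.1 ha
  refine hφ.update (fun u w h hne => adj_deleteEdge ((SimpleGraph.deleteEdges_adj.1 h).1) hne) ha'.1
    (fun u h hne => ha'.2 u (SimpleGraph.deleteEdges_adj.1 h).1 hne) ?_
  intro u h hne
  rw [SimpleGraph.deleteEdges_adj] at h
  refine hφ.ne (adj_deleteEdge h.1 hne) (adj_deleteEdge hxz ?_) ?_
  · rw [Sym2.eq_swap (a := y)]
    exact fun h => hyz (Sym2.congr_right.1 h).symm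
  · rintro rfl
    exact h.2 rfl

theorem mem_shift {y x z v : V} {c : ℕ} (hca : c ≠ φ s(x, z)) (hc : c ∈ m6 G Δ φ y x v) :
    c ∈ m6 G Δ (Function.update φ s(y, x) (φ s(x, z))) x z v := by
  rw [mem_m6] at hc ⊢
  refine ⟨hc.1, fun u hu _ => ?_⟩
  by_cases h : s(v, u) = s(y, x)
  · rw [h, Function.update_self]
    exact hca.symm
  · rw [Function.update_of_ne h]
    exact hc.2 u hu h

theorem color_mem_shift {y x z : V} (hφ : IsProperEdgeColoring (G.deleteEdges {s(y, x)}) Δ φ)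
    (hxz : G.Adj x z) (hyz : y ≠ z) :
    φ s(x, z) ∈ m6 G Δ (Function.update φ s(y, x) (φ s(x, z))) x z z := by
  have hz : ∀ u, s(z, u) ≠ s(y, x) := by
    intro u h
    have : z ∈ s(y, x) := h ▸ Sym2.mem_mk_left z u
    rcases Sym2.mem_iff.1 this with h | h
    · exact hyz h.symm
    · exact hxz.ne h.symm
  have hx : s(x, z) ≠ s(y, x) := by
    rw [Sym2.eq_swap]
    exact hz x
  rw [mem_m6]
  refine ⟨hφ.1 _ (adj_deleteEdge hxz hx), fun u hu hne => ?_⟩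
  rw [Function.update_of_ne (hz u), Sym2.eq_swap (a := x)]
  refine hφ.ne (adj_deleteEdge hu (hz u)) (adj_deleteEdge hxz.symm (hz x)) ?_
  rintro rfl
  exact hne Sym2.eq_swap

theorem edge_ne {y x z : V} (hyz : y ≠ z) : s(x, z) ≠ s(y, x) := by
  rw [Sym2.eq_swap (a := y)]
  exact fun h => hyz (Sym2.congr_right.1 h).symm

theorem fan_center_disjoint (hG : ¬ ∃ ψ, IsProperEdgeColoring G Δ ψ) {y x z : V}
    (hφ : IsProperEdgeColoring (G.deleteEdges {s(y, x)}) Δ φ)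
    (hxz : G.Adj x z) (hyz : y ≠ z) (ha : φ s(x, z) ∈ m6 G Δ φ y x y) {c : ℕ}
    (hx : c ∈ m6 G Δ φ y x x) (hz : c ∈ m6 G Δ φ y x z) : False := by
  have hca : c ≠ φ s(x, z) := (color_ne_of_mem_m6 hxz (edge_ne hyz) hx).symm
  exact ends_disjoint hG (shift_proper hφ hxz hyz ha) (mem_shift hca hx) (mem_shift hca hz)

theorem fan_linked (hG : ¬ ∃ ψ, IsProperEdgeColoring G Δ ψ) {y x z : V}
    (hφ : IsProperEdgeColoring (G.deleteEdges {s(y, x)}) Δ φ)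
    (hxz : G.Adj x z) (hyz : y ≠ z) (ha : φ s(x, z) ∈ m6 G Δ φ y x y) {α β : ℕ}
    (hx : α ∈ m6 G Δ φ y x x) (hz : β ∈ m6 G Δ φ y x z) :
    (kempe (G.deleteEdges {s(y, x)}) φ α β).Reachable x z := by
  by_contra hr
  have hα := color_ne_of_mem_m6 hxz (edge_ne hyz) hx
  have hβ := color_ne_of_mem_m6' hxz (edge_ne hyz) hz
  obtain ⟨ψ, hψ, h1, h2, h3, h4⟩ := hφ.exists_swap (mem_m6.1 hx).1 (mem_m6.1 hz).1 x
  have he := h4 x z (adj_deleteEdge hxz (edge_ne hyz)) (Or.inl ⟨hα, hβ⟩)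
  refine fan_center_disjoint hG hψ hxz hyz (c := β) ?_
    ((h1 x (SimpleGraph.Reachable.refl x)).2.2 hx) ?_
  · rw [he]
    exact (h3 y _ hα hβ).2 ha
  · rw [m6, h2 z hr]
    exact hz

theorem fan_leaves_disjoint [Fintype V] (hG : ¬ ∃ ψ, IsProperEdgeColoring G Δ ψ) {y x z : V}
    (hφ : IsProperEdgeColoring (G.deleteEdges {s(y, x)}) Δ φ) (hyx : G.Adj y x)
    (hxz : G.Adj x z) (hyz : y ≠ z) (ha : φ s(x, z) ∈ m6 G Δ φ y x y)
    (hne : (m6 G Δ φ y x x).Nonempty) {c : ℕ}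
    (hy : c ∈ m6 G Δ φ y x y) (hz : c ∈ m6 G Δ φ y x z) : False := by
  obtain ⟨α, hα⟩ := hne
  have r1 := ends_linked hG hφ hy hα
  rw [kempe_comm] at r1
  exact hφ.not_three_ends hyx.ne.symm hxz.ne hyz (Or.inl hα) (Or.inr hy) (Or.inr hz) r1.symm
    (fan_linked hG hφ hxz hyz ha hα hz)

theorem le_card_m6 [Fintype V] (φ : Sym2 V → ℕ) (x y v : V) :
    Δ ≤ G.degree v + (m6 G Δ φ x y v).card := by
  have hsub : Finset.Icc 1 Δ ⊆
      (G.neighborFinset v).image (fun u => φ s(v, u)) ∪ m6 G Δ φ x y v := by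
    intro c hc
    by_cases h : c ∈ m6 G Δ φ x y v
    · exact Finset.mem_union_right _ h
    · rw [mem_m6] at h
      push Not at h
      obtain ⟨u, hu, -, rfl⟩ := h hc
      exact Finset.mem_union_left _ (Finset.mem_image.2 ⟨u, by simpa using hu, rfl⟩)
  have h1 := Finset.card_le_card hsub
  have h2 := Finset.card_union_le ((G.neighborFinset v).image (fun u => φ s(v, u)))
    (m6 G Δ φ x y v)
  have h3 : ((G.neighborFinset v).image (fun u => φ s(v, u))).card ≤ _ := Finset.card_image_le
  rw [SimpleGraph.card_neighborFinset_eq_degree] at h3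
  rw [Nat.card_Icc] at h1
  omega

theorem lt_card_m6_right [Fintype V] (φ : Sym2 V → ℕ) {y x : V} (hyx : G.Adj y x) :
    Δ < G.degree x + (m6 G Δ φ y x x).card := by
  have hsub : Finset.Icc 1 Δ ⊆
      ((G.neighborFinset x).erase y).image (fun u => φ s(x, u)) ∪ m6 G Δ φ y x x := by
    intro c hc
    by_cases h : c ∈ m6 G Δ φ y x x
    · exact Finset.mem_union_right _ h
    · rw [mem_m6] at h
      push Not at h
      obtain ⟨u, hu, hne, rfl⟩ := h hc
      refine Finset.mem_union_left _ (Finset.mem_image.2 ⟨u, ?_, rfl⟩)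
      rw [Finset.mem_erase, SimpleGraph.mem_neighborFinset]
      refine ⟨?_, hu⟩
      rintro rfl
      exact hne Sym2.eq_swap
  have h1 := Finset.card_le_card hsub
  have h2 := Finset.card_union_le (((G.neighborFinset x).erase y).image (fun u => φ s(x, u)))
    (m6 G Δ φ y x x)
  have h3 : (((G.neighborFinset x).erase y).image (fun u => φ s(x, u))).card ≤ _ :=
    Finset.card_image_le
  have hmem : y ∈ G.neighborFinset x := by simpa using hyx.symm
  have h4 := Finset.card_erase_add_one hmem
  rw [SimpleGraph.card_neighborFinset_eq_degree] at h4
  rw [Nat.card_Icc] at h1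
  omega

end Fan

section Broom

/-- `y0, y1, y2, y3` is a path in `G` on four vertices. -/
structure IsBroomPath (G : SimpleGraph V) (y0 y1 y2 y3 : V) : Prop where
  adj01 : G.Adj y0 y1
  adj12 : G.Adj y1 y2
  adj23 : G.Adj y2 y3
  ne02 : y0 ≠ y2
  ne03 : y0 ≠ y3
  ne13 : y1 ≠ y3

/-- A colouring of `G - y0y1` for which `y0, y1, y2, y3` is a Kierstead path. -/
structure IsKiersteadColoring (G : SimpleGraph V) (Δ : ℕ) (y0 y1 y2 y3 : V)
    (φ : Sym2 V → ℕ) : Prop where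
  proper : IsProperEdgeColoring (G.deleteEdges {s(y0, y1)}) Δ φ
  color12 : φ s(y1, y2) ∈ m6 G Δ φ y0 y1 y0
  color23 : φ s(y2, y3) ∈ m6 G Δ φ y0 y1 y0 ∪ m6 G Δ φ y0 y1 y1

variable {G : SimpleGraph V} {Δ : ℕ} {φ : Sym2 V → ℕ} {y0 y1 y2 y3 : V}

theorem IsBroomPath.edge23_ne (P : IsBroomPath G y0 y1 y2 y3) : s(y2, y3) ≠ s(y0, y1) := by
  intro h
  have : y2 ∈ s(y0, y1) := h ▸ Sym2.mem_mk_left y2 y3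
  rcases Sym2.mem_iff.1 this with h | h
  · exact P.ne02 h.symm
  · exact P.adj12.ne h.symm

theorem IsBroomPath.del12 (P : IsBroomPath G y0 y1 y2 y3) :
    (G.deleteEdges {s(y0, y1)}).Adj y1 y2 :=
  adj_deleteEdge P.adj12 (edge_ne P.ne02)

theorem IsBroomPath.del23 (P : IsBroomPath G y0 y1 y2 y3) :
    (G.deleteEdges {s(y0, y1)}).Adj y2 y3 :=
  adj_deleteEdge P.adj23 P.edge23_ne

theorem IsKiersteadColoring.color12_ne_color23 (K : IsKiersteadColoring G Δ y0 y1 y2 y3 φ)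
    (P : IsBroomPath G y0 y1 y2 y3) : φ s(y1, y2) ≠ φ s(y2, y3) := by
  rw [Sym2.eq_swap]
  exact K.proper.ne P.del12.symm P.del23 P.ne13

theorem m6_nonempty_right [Fintype V] (hΔ : ∀ v, G.degree v ≤ Δ) (φ : Sym2 V → ℕ) {y x : V}
    (hyx : G.Adj y x) : (m6 G Δ φ y x x).Nonempty := by
  rw [← Finset.card_pos]
  have h1 := lt_card_m6_right (Δ := Δ) φ hyx
  have h2 := hΔ x
  omega

theorem IsKiersteadColoring.disjoint23 [Fintype V] (hG : ¬ ∃ ψ, IsProperEdgeColoring G Δ ψ)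
    (hΔ : ∀ v, G.degree v ≤ Δ) (P : IsBroomPath G y0 y1 y2 y3)
    (K : IsKiersteadColoring G Δ y0 y1 y2 y3 φ) {α : ℕ}
    (h2 : α ∈ m6 G Δ φ y0 y1 y2) (h3 : α ∈ m6 G Δ φ y0 y1 y3) : False := by
  have hbα := color_ne_of_mem_m6 P.adj23 P.edge23_ne h2
  set φ' := Function.update φ s(y2, y3) α with hφ'
  have hproper : IsProperEdgeColoring (G.deleteEdges {s(y0, y1)}) Δ φ' :=
    K.proper.update (fun _ _ h _ => h) (mem_m6.1 h2).1
      (fun u h _ => (mem_missing.1 h2).2 u h) (fun u h _ => (mem_missing.1 h3).2 u h)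
  have hkeep : ∀ v c, v ≠ y2 → v ≠ y3 → c ∈ m6 G Δ φ y0 y1 v → c ∈ m6 G Δ φ' y0 y1 v := by
    intro v c hv2 hv3 hc
    rw [mem_m6] at hc ⊢
    refine ⟨hc.1, fun u hu hne => ?_⟩
    have : s(v, u) ≠ s(y2, y3) := by
      intro h
      have : v ∈ s(y2, y3) := h ▸ Sym2.mem_mk_left v u
      rcases Sym2.mem_iff.1 this with h | h
      · exact hv2 h
      · exact hv3 h
    rw [hφ', Function.update_of_ne this]
    exact hc.2 u hu hne
  have hb : φ s(y2, y3) ∈ m6 G Δ φ' y0 y1 y2 := by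
    rw [mem_m6]
    refine ⟨K.proper.1 _ P.del23, fun u hu hne => ?_⟩
    by_cases h : s(y2, u) = s(y2, y3)
    · rw [h, hφ', Function.update_self]
      exact hbα.symm
    · rw [hφ', Function.update_of_ne h]
      refine K.proper.ne (adj_deleteEdge hu hne) P.del23 ?_
      rintro rfl
      exact h rfl
  have ha : φ' s(y1, y2) = φ s(y1, y2) := by
    rw [hφ', Function.update_of_ne]
    rw [Sym2.eq_swap]
    exact fun h => P.ne13 (Sym2.congr_right.1 h)
  have ha0 : φ' s(y1, y2) ∈ m6 G Δ φ' y0 y1 y0 := by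
    rw [ha]
    exact hkeep y0 _ P.ne02 P.ne03 K.color12
  rcases Finset.mem_union.1 K.color23 with h | h
  · exact fan_leaves_disjoint hG hproper P.adj01 P.adj12 P.ne02 ha0
      (m6_nonempty_right hΔ _ P.adj01) (hkeep y0 _ P.ne02 P.ne03 h) hb
  · exact fan_center_disjoint hG hproper P.adj12 P.ne02 ha0
      (hkeep y1 _ P.adj12.ne P.ne13 h) hb

theorem IsKiersteadColoring.disjoint13_of_color23_mem [Fintype V]
    (hG : ¬ ∃ ψ, IsProperEdgeColoring G Δ ψ)
    (P : IsBroomPath G y0 y1 y2 y3)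
    (K : IsKiersteadColoring G Δ y0 y1 y2 y3 φ) (hb : φ s(y2, y3) ∈ m6 G Δ φ y0 y1 y1) :
    φ s(y1, y2) ∉ m6 G Δ φ y0 y1 y3 ∧
      ∀ α ∈ m6 G Δ φ y0 y1 y1, α ∉ m6 G Δ φ y0 y1 y3 := by
  set φ' := Function.update φ s(y0, y1) (φ s(y1, y2)) with hφ'
  have hproper : IsProperEdgeColoring (G.deleteEdges {s(y1, y2)}) Δ φ' :=
    shift_proper K.proper P.adj12 P.ne02 K.color12
  have hab := K.color12_ne_color23 P
  have hb' : φ' s(y2, y3) = φ s(y2, y3) := by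
    rw [hφ', Function.update_of_ne P.edge23_ne]
  have hb1 : φ' s(y2, y3) ∈ m6 G Δ φ' y1 y2 y1 := by
    rw [hb']
    exact mem_shift hab.symm hb
  have ha2 : φ s(y1, y2) ∈ m6 G Δ φ' y1 y2 y2 := color_mem_shift K.proper P.adj12 P.ne02
  constructor
  · intro h
    refine fan_center_disjoint hG hproper P.adj23 P.ne13 hb1 ha2 ?_
    rw [mem_m6] at h ⊢
    refine ⟨h.1, fun u hu hne => ?_⟩
    have : s(y3, u) ≠ s(y0, y1) := by
      intro h
      have : y3 ∈ s(y0, y1) := h ▸ Sym2.mem_mk_left y3 u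
      rcases Sym2.mem_iff.1 this with h | h
      · exact P.ne03 h.symm
      · exact P.ne13 h.symm
    rw [hφ', Function.update_of_ne this]
    exact h.2 u hu this
  · intro α h1 h3
    have hα : α ≠ φ s(y1, y2) := (color_ne_of_mem_m6 P.adj12 (edge_ne P.ne02) h1).symm
    exact fan_leaves_disjoint hG hproper P.adj12 P.adj23 P.ne13 hb1 ⟨_, ha2⟩
      (mem_shift hα h1) (mem_shift hα h3)

/-- Replace a colour missing at `y3` by one missing at `x`, through a Kempe change at `y3`. -/
theorem IsKiersteadColoring.transfer (P : IsBroomPath G y0 y1 y2 y3)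
    (K : IsKiersteadColoring G Δ y0 y1 y2 y3 φ) {α γ : ℕ} {x : V}
    (hα : α ∈ m6 G Δ φ y0 y1 y3) (hγ : γ ∈ m6 G Δ φ y0 y1 x)
    (hx : ¬ (kempe (G.deleteEdges {s(y0, y1)}) φ α γ).Reachable y3 x)
    (hbγ : φ s(y2, y3) ≠ γ)
    (ha : (φ s(y1, y2) ≠ α ∧ φ s(y1, y2) ≠ γ) ∨
      (¬ (kempe (G.deleteEdges {s(y0, y1)}) φ α γ).Reachable y3 y0 ∧
        ¬ (kempe (G.deleteEdges {s(y0, y1)}) φ α γ).Reachable y3 y1)) :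
    ∃ ψ, IsKiersteadColoring G Δ y0 y1 y2 y3 ψ ∧ γ ∈ m6 G Δ ψ y0 y1 x ∧
      γ ∈ m6 G Δ ψ y0 y1 y3 ∧
      (φ s(y2, y3) ∈ m6 G Δ φ y0 y1 y1 → ψ s(y2, y3) ∈ m6 G Δ ψ y0 y1 y1) := by
  have hbα := color_ne_of_mem_m6' P.adj23 P.edge23_ne hα
  obtain ⟨ψ, hψ, h1, h2, h3, h4⟩ := K.proper.exists_swap (mem_m6.1 hα).1 (mem_m6.1 hγ).1 y3
  have eb := h4 y2 y3 P.del23 (Or.inl ⟨hbα, hbγ⟩)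
  have ea : ψ s(y1, y2) = φ s(y1, y2) :=
    h4 y1 y2 P.del12 (ha.imp_right fun h => h.2)
  refine ⟨ψ, ⟨hψ, ?_, ?_⟩, ?_, (h1 y3 (SimpleGraph.Reachable.refl y3)).2.2 hα, ?_⟩
  · rw [ea]
    rcases ha with ha | ha
    · exact (h3 y0 _ ha.1 ha.2).2 K.color12
    · rw [m6, h2 y0 ha.1]
      exact K.color12
  · rw [eb, Finset.mem_union]
    exact (Finset.mem_union.1 K.color23).imp (h3 y0 _ hbα hbγ).2 (h3 y1 _ hbα hbγ).2
  · rw [m6, h2 x hx]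
    exact hγ
  · intro h
    rw [eb]
    exact (h3 y1 _ hbα hbγ).2 h

theorem IsKiersteadColoring.not_mem_of_linked2 [Fintype V]
    (hG : ¬ ∃ ψ, IsProperEdgeColoring G Δ ψ)
    (hΔ : ∀ v, G.degree v ≤ Δ) (P : IsBroomPath G y0 y1 y2 y3)
    (K : IsKiersteadColoring G Δ y0 y1 y2 y3 φ) {α γ : ℕ} {x : V}
    (hx2 : x ≠ y2) (hx3 : x ≠ y3) (hγ : γ ∈ m6 G Δ φ y0 y1 y2) (hα : α ∈ m6 G Δ φ y0 y1 x)
    (hlink : (kempe (G.deleteEdges {s(y0, y1)}) φ α γ).Reachable x y2)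
    (haα : φ s(y1, y2) ≠ α) : α ∉ m6 G Δ φ y0 y1 y3 := by
  intro h3
  have hr : ¬ (kempe (G.deleteEdges {s(y0, y1)}) φ α γ).Reachable y3 y2 := fun h =>
    K.proper.not_three_ends hx2 hx3 P.adj23.ne (Or.inl hα) (Or.inr hγ) (Or.inl h3) hlink
      (hlink.trans h.symm)
  obtain ⟨ψ, hψ, g2, g3, -⟩ := K.transfer P h3 hγ hr (color_ne_of_mem_m6 P.adj23 P.edge23_ne hγ)
    (Or.inl ⟨haα, color_ne_of_mem_m6' P.adj12 (edge_ne P.ne02) hγ⟩)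
  exact hψ.disjoint23 hG hΔ P g2 g3

/-- A colour shared by `y0` and `y3` can be replaced by one shared by `y1` and `y3`. -/
theorem IsKiersteadColoring.transfer_to1 [Fintype V] (hG : ¬ ∃ ψ, IsProperEdgeColoring G Δ ψ)
    (P : IsBroomPath G y0 y1 y2 y3)
    (K : IsKiersteadColoring G Δ y0 y1 y2 y3 φ) {α γ : ℕ}
    (h0 : α ∈ m6 G Δ φ y0 y1 y0) (h3 : α ∈ m6 G Δ φ y0 y1 y3) (h1 : γ ∈ m6 G Δ φ y0 y1 y1)
    (hγ : γ ≠ φ s(y2, y3)) :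
    ∃ ψ, IsKiersteadColoring G Δ y0 y1 y2 y3 ψ ∧ γ ∈ m6 G Δ ψ y0 y1 y1 ∧
      γ ∈ m6 G Δ ψ y0 y1 y3 ∧
      (φ s(y2, y3) ∈ m6 G Δ φ y0 y1 y1 → ψ s(y2, y3) ∈ m6 G Δ ψ y0 y1 y1) := by
  have r01 := ends_linked hG K.proper h0 h1
  have r0 : ¬ (kempe (G.deleteEdges {s(y0, y1)}) φ α γ).Reachable y3 y0 := fun h =>
    K.proper.not_three_ends P.adj01.ne P.ne03 P.ne13 (Or.inl h0) (Or.inr h1) (Or.inl h3)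
      r01 h.symm
  have r1 : ¬ (kempe (G.deleteEdges {s(y0, y1)}) φ α γ).Reachable y3 y1 := fun h =>
    r0 (h.trans r01.symm)
  exact K.transfer P h3 h1 r1 hγ.symm (Or.inr ⟨r0, r1⟩)

theorem IsKiersteadColoring.disjoint13 [Fintype V] (hG : ¬ ∃ ψ, IsProperEdgeColoring G Δ ψ)
    (hΔ : ∀ v, G.degree v ≤ Δ) (hdeg : G.degree y1 < Δ ∨ G.degree y2 < Δ)
    (P : IsBroomPath G y0 y1 y2 y3) (K : IsKiersteadColoring G Δ y0 y1 y2 y3 φ) {α : ℕ}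
    (h1 : α ∈ m6 G Δ φ y0 y1 y1) (h3 : α ∈ m6 G Δ φ y0 y1 y3) : False := by
  have haα := color_ne_of_mem_m6 P.adj12 (edge_ne P.ne02) h1
  rcases hdeg with hd | hd
  · by_cases hb : φ s(y2, y3) ∈ m6 G Δ φ y0 y1 y1
    · exact (K.disjoint13_of_color23_mem hG P hb).2 α h1 h3
    · have hb0 := (Finset.mem_union.1 K.color23).resolve_right hb
      set b := φ s(y2, y3)
      have hbα : b ≠ α := color_ne_of_mem_m6' P.adj23 P.edge23_ne h3
      have r01 := ends_linked hG K.proper hb0 h1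
      have r0 : ¬ (kempe (G.deleteEdges {s(y0, y1)}) φ b α).Reachable y0 y3 := fun h =>
        K.proper.not_three_ends P.adj01.ne P.ne03 P.ne13 (Or.inl hb0) (Or.inr h1) (Or.inr h3)
          r01 h
      have r2 : ¬ (kempe (G.deleteEdges {s(y0, y1)}) φ b α).Reachable y0 y2 := fun h =>
        r0 (h.trans (SimpleGraph.Adj.reachable ⟨P.del23, Or.inl rfl⟩))
      obtain ⟨ψ, hψ, g1, g2, g3, g4⟩ :=
        K.proper.exists_swap (mem_m6.1 hb0).1 (mem_m6.1 h1).1 y0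
      have hab := K.color12_ne_color23 P
      have eb : ψ s(y2, y3) = b := g4 y2 y3 P.del23 (Or.inr r2)
      have ea : ψ s(y1, y2) = φ s(y1, y2) := g4 y1 y2 P.del12 (Or.inl ⟨hab, haα⟩)
      have hb1 : b ∈ m6 G Δ ψ y0 y1 y1 := (g1 y1 r01).1.2 h1
      have Kψ : IsKiersteadColoring G Δ y0 y1 y2 y3 ψ := by
        refine ⟨hψ, ?_, ?_⟩
        · rw [ea]
          exact (g3 y0 _ hab haα).2 K.color12
        · rw [eb]
          exact Finset.mem_union_right _ hb1
      have k0 : α ∈ m6 G Δ ψ y0 y1 y0 := (g1 y0 (SimpleGraph.Reachable.refl y0)).2.2 hb0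
      have k3 : α ∈ m6 G Δ ψ y0 y1 y3 := by
        rw [m6, g2 y3 r0]
        exact h3
      have hc : 1 < (m6 G Δ ψ y0 y1 y1).card := by
        have := lt_card_m6_right (Δ := Δ) ψ P.adj01
        omega
      obtain ⟨γ, hγ, hγb⟩ := Finset.exists_mem_ne hc b
      obtain ⟨χ, Kχ, c1, c3, cb⟩ := Kψ.transfer_to1 hG P k0 k3 hγ (by rwa [eb])
      exact (Kχ.disjoint13_of_color23_mem hG P (cb (by rwa [eb]))).2 γ c1 c3
  · have hne : (m6 G Δ φ y0 y1 y2).Nonempty := by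
      rw [← Finset.card_pos]
      have := le_card_m6 (G := G) (Δ := Δ) φ y0 y1 y2
      omega
    obtain ⟨γ, hγ⟩ := hne
    exact K.not_mem_of_linked2 hG hΔ P P.adj12.ne P.ne13 hγ h1
      (fan_linked hG K.proper P.adj12 P.ne02 K.color12 h1 hγ) haα h3

theorem IsKiersteadColoring.linked02 [Fintype V] (hG : ¬ ∃ ψ, IsProperEdgeColoring G Δ ψ)
    (hΔ : ∀ v, G.degree v ≤ Δ) (P : IsBroomPath G y0 y1 y2 y3)
    (K : IsKiersteadColoring G Δ y0 y1 y2 y3 φ) {α γ : ℕ}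
    (h0 : α ∈ m6 G Δ φ y0 y1 y0) (h2 : γ ∈ m6 G Δ φ y0 y1 y2) (haα : φ s(y1, y2) ≠ α) :
    (kempe (G.deleteEdges {s(y0, y1)}) φ α γ).Reachable y0 y2 := by
  by_contra hr
  have haγ := color_ne_of_mem_m6' P.adj12 (edge_ne P.ne02) h2
  obtain ⟨ψ, hψ, g1, g2, g3, g4⟩ := K.proper.exists_swap (mem_m6.1 h0).1 (mem_m6.1 h2).1 y0
  have ea : ψ s(y1, y2) = φ s(y1, y2) := g4 y1 y2 P.del12 (Or.inl ⟨haα, haγ⟩)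
  refine fan_leaves_disjoint hG hψ P.adj01 P.adj12 P.ne02 ?_ (m6_nonempty_right hΔ _ P.adj01)
    ((g1 y0 (SimpleGraph.Reachable.refl y0)).2.2 h0) ?_
  · rw [ea]
    exact (g3 y0 _ haα haγ).2 K.color12
  · rw [m6, g2 y2 hr]
    exact h2

theorem IsKiersteadColoring.disjoint03 [Fintype V] (hG : ¬ ∃ ψ, IsProperEdgeColoring G Δ ψ)
    (hΔ : ∀ v, G.degree v ≤ Δ) (hdeg : G.degree y1 < Δ ∨ G.degree y2 < Δ)
    (P : IsBroomPath G y0 y1 y2 y3) (K : IsKiersteadColoring G Δ y0 y1 y2 y3 φ) {α : ℕ}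
    (h0 : α ∈ m6 G Δ φ y0 y1 y0) (h3 : α ∈ m6 G Δ φ y0 y1 y3) : False := by
  by_cases hex : ∃ γ ∈ m6 G Δ φ y0 y1 y1, γ ≠ φ s(y2, y3)
  · obtain ⟨γ, hγ, hγb⟩ := hex
    obtain ⟨ψ, hψ, c1, c3, -⟩ := K.transfer_to1 hG P h0 h3 hγ hγb
    exact hψ.disjoint13 hG hΔ hdeg P c1 c3
  · push Not at hex
    obtain ⟨β, hβ⟩ := m6_nonempty_right hΔ φ P.adj01
    have hb : φ s(y2, y3) ∈ m6 G Δ φ y0 y1 y1 := hex β hβ ▸ hβ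
    have haα : φ s(y1, y2) ≠ α := by
      rintro rfl
      exact (K.disjoint13_of_color23_mem hG P hb).1 h3
    have hc : (m6 G Δ φ y0 y1 y1).card ≤ 1 :=
      Finset.card_le_one.2 fun c hc d hd => (hex c hc).trans (hex d hd).symm
    have hd1 := lt_card_m6_right (Δ := Δ) φ P.adj01
    have hd2 := le_card_m6 (G := G) (Δ := Δ) φ y0 y1 y2
    have hne : (m6 G Δ φ y0 y1 y2).Nonempty := by
      rw [← Finset.card_pos]
      omega
    obtain ⟨γ, hγ⟩ := hne
    exact K.not_mem_of_linked2 hG hΔ P P.ne02 P.ne03 hγ h0 (K.linked02 hG hΔ P h0 hγ haα) haα h3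

theorem IsKiersteadColoring.disjoint_leaves [Fintype V] {y4 : V}
    (hG : ¬ ∃ ψ, IsProperEdgeColoring G Δ ψ)
    (hΔ : ∀ v, G.degree v ≤ Δ) (hdeg : G.degree y1 < Δ ∨ G.degree y2 < Δ)
    (P : IsBroomPath G y0 y1 y2 y3) (K : IsKiersteadColoring G Δ y0 y1 y2 y3 φ)
    (P' : IsBroomPath G y0 y1 y2 y4) (K' : IsKiersteadColoring G Δ y0 y1 y2 y4 φ)
    (hne : y3 ≠ y4) (hcard : 4 ≤ (m6 G Δ φ y0 y1 y0 ∪ m6 G Δ φ y0 y1 y1).card) {α : ℕ}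
    (h3 : α ∈ m6 G Δ φ y0 y1 y3) (h4 : α ∈ m6 G Δ φ y0 y1 y4) : False := by
  have hT : ({φ s(y1, y2), φ s(y2, y3), φ s(y2, y4)} : Finset ℕ).card ≤ 3 := Finset.card_le_three
  obtain ⟨γ, hγ, hγT⟩ := Finset.exists_mem_notMem_of_card_lt_card (hT.trans_lt hcard)
  simp only [Finset.mem_insert, Finset.mem_singleton, not_or] at hγT
  have haα : φ s(y1, y2) ≠ α := by
    rintro rfl
    exact K.disjoint03 hG hΔ hdeg P K.color12 h3
  have step : ∀ x, γ ∈ m6 G Δ φ y0 y1 x → x ≠ y3 → x ≠ y4 →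
      (∀ z ψ, IsBroomPath G y0 y1 y2 z → IsKiersteadColoring G Δ y0 y1 y2 z ψ →
        γ ∈ m6 G Δ ψ y0 y1 x → γ ∈ m6 G Δ ψ y0 y1 z → False) → False := by
    intro x hx hx3 hx4 hfin
    by_cases hr : (kempe (G.deleteEdges {s(y0, y1)}) φ α γ).Reachable y3 x
    · have hr' : ¬ (kempe (G.deleteEdges {s(y0, y1)}) φ α γ).Reachable y4 x := fun h =>
        K.proper.not_three_ends hx3 hx4 hne (Or.inr hx) (Or.inl h3) (Or.inl h4) hr.symm h.symm
      obtain ⟨ψ, hψ, gx, gz, -⟩ := K'.transfer P' h4 hx hr' (Ne.symm hγT.2.2)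
        (Or.inl ⟨haα, Ne.symm hγT.1⟩)
      exact hfin y4 ψ P' hψ gx gz
    · obtain ⟨ψ, hψ, gx, gz, -⟩ := K.transfer P h3 hx hr (Ne.symm hγT.2.1)
        (Or.inl ⟨haα, Ne.symm hγT.1⟩)
      exact hfin y3 ψ P hψ gx gz
  rcases Finset.mem_union.1 hγ with h | h
  · exact step y0 h P.ne03 P'.ne03 fun z ψ Pz Kz a b => Kz.disjoint03 hG hΔ hdeg Pz a b
  · exact step y1 h P.ne13 P'.ne13 fun z ψ Pz Kz a b => Kz.disjoint13 hG hΔ hdeg Pz a b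

end Broom

theorem stmt6 (G : SimpleGraph V) [Fintype V] (Δ : ℕ) (hc : EdgeCritical G Δ)
    (y0 y1 y2 : V) (h01 : G.Adj y0 y1) (h12 : G.Adj y1 y2) (h02 : y0 ≠ y2)
    (φ : Sym2 V → ℕ)
    (hφ : IsProperEdgeColoring (G.deleteEdges {s(y0, y1)}) Δ φ)
    (Y : Finset V)
    (hY : ∀ w ∈ Y, G.Adj y2 w ∧ w ≠ y0 ∧ w ≠ y1 ∧ w ≠ y2)
    (he2 : φ s(y1, y2) ∈ m6 G Δ φ y0 y1 y0 ∪ m6 G Δ φ y0 y1 y1)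
    (heY : ∀ w ∈ Y, φ s(y2, w) ∈ m6 G Δ φ y0 y1 y0 ∪ m6 G Δ φ y0 y1 y1)
    (hcard : 4 ≤ (m6 G Δ φ y0 y1 y0 ∪ m6 G Δ φ y0 y1 y1).card)
    (hdeg : min (G.degree y1) (G.degree y2) < Δ) :
    ∀ u ∈ insert y0 (insert y1 (insert y2 Y)), ∀ v ∈ insert y0 (insert y1 (insert y2 Y)),
      u ≠ v → m6 G Δ φ y0 y1 u ∩ m6 G Δ φ y0 y1 v = ∅ := by
  obtain ⟨hmax, hG, -, -⟩ := hc
  have hΔ : ∀ v, G.degree v ≤ Δ := fun v => hmax ▸ G.degree_le_maxDegree v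
  have hdeg' : G.degree y1 < Δ ∨ G.degree y2 < Δ := min_lt_iff.1 hdeg
  have ha : φ s(y1, y2) ∈ m6 G Δ φ y0 y1 y0 :=
    (Finset.mem_union.1 he2).resolve_right fun h =>
      color_ne_of_mem_m6 h12 (edge_ne h02) h rfl
  have hne := m6_nonempty_right hΔ φ h01
  have hP : ∀ w ∈ Y, IsBroomPath G y0 y1 y2 w := fun w hw =>
    ⟨h01, h12, (hY w hw).1, h02, (hY w hw).2.1.symm, (hY w hw).2.2.1.symm⟩
  have hK : ∀ w ∈ Y, IsKiersteadColoring G Δ y0 y1 y2 w φ := fun w hw => ⟨hφ, ha, heY w hw⟩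
  have d01 : Disjoint (m6 G Δ φ y0 y1 y0) (m6 G Δ φ y0 y1 y1) :=
    Finset.disjoint_left.2 fun _ h h' => ends_disjoint hG hφ h h'
  have d02 : Disjoint (m6 G Δ φ y0 y1 y0) (m6 G Δ φ y0 y1 y2) :=
    Finset.disjoint_left.2 fun _ h h' => fan_leaves_disjoint hG hφ h01 h12 h02 ha hne h h'
  have d12 : Disjoint (m6 G Δ φ y0 y1 y1) (m6 G Δ φ y0 y1 y2) :=
    Finset.disjoint_left.2 fun _ h h' => fan_center_disjoint hG hφ h12 h02 ha h h'
  have d0 : ∀ w ∈ Y, Disjoint (m6 G Δ φ y0 y1 y0) (m6 G Δ φ y0 y1 w) := fun w hw =>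
    Finset.disjoint_left.2 fun _ h h' => (hK w hw).disjoint03 hG hΔ hdeg' (hP w hw) h h'
  have d1 : ∀ w ∈ Y, Disjoint (m6 G Δ φ y0 y1 y1) (m6 G Δ φ y0 y1 w) := fun w hw =>
    Finset.disjoint_left.2 fun _ h h' => (hK w hw).disjoint13 hG hΔ hdeg' (hP w hw) h h'
  have d2 : ∀ w ∈ Y, Disjoint (m6 G Δ φ y0 y1 y2) (m6 G Δ φ y0 y1 w) := fun w hw =>
    Finset.disjoint_left.2 fun _ h h' => (hK w hw).disjoint23 hG hΔ (hP w hw) h h'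
  have dY : ∀ w ∈ Y, ∀ z ∈ Y, w ≠ z → Disjoint (m6 G Δ φ y0 y1 w) (m6 G Δ φ y0 y1 z) :=
    fun w hw z hz hwz => Finset.disjoint_left.2 fun _ h h' =>
      (hK w hw).disjoint_leaves hG hΔ hdeg' (hP w hw) (hP z hz) (hK z hz) hwz hcard h h'
  intro u hu v hv huv
  rw [← Finset.disjoint_iff_inter_eq_empty]
  simp only [Finset.mem_insert] at hu hv
  rcases hu with rfl | rfl | rfl | hu <;> rcases hv with rfl | rfl | rfl | hv
  · exact absurd rfl huv
  · exact d01
  · exact d02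
  · exact d0 v hv
  · exact d01.symm
  · exact absurd rfl huv
  · exact d12
  · exact d1 v hv
  · exact d02.symm
  · exact d12.symm
  · exact absurd rfl huv
  · exact d2 v hv
  · exact (d0 u hu).symm
  · exact (d1 u hu).symm
  · exact (d2 u hu).symm
  · exact dY u hu v hv huv
end

section
/- Let G be a simple edge-Δ-critical graph, x ∈ V(G), and q a positive number with Δ/2 < q ≤ Δ - d(x)/2 - 2. Then x has at least d(x) - p(x,q) - 3 neighbors y with σ_q(x,y) ≥ Δ - p(x,q) - 5, where p(x,q) = min{ min_{y∈N(x)} σ_q(x,y) - Δ + d(x) - 1, ⌊d(x)/2⌋ - 3 }. -/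
open Finset
open scoped Classical

variable {V : Type*}

/-- `σ_q(x,y)`: the number of neighbors `z ≠ x` of `y` with `d(z) ≥ q`. -/
noncomputable def sigmaQ (G : SimpleGraph V) [Fintype V] (q : ℝ) (x y : V) : ℕ :=
  (Finset.univ.filter (fun z => G.Adj y z ∧ z ≠ x ∧ q ≤ (G.degree z : ℝ))).card

namespace EdgeCol

/-- A finite graph of maximum degree at most two has no component containing three distinct
vertices of degree at most one. -/
lemma not_reachable_three [Fintype V] (K : SimpleGraph V) (h2 : ∀ v, K.degree v ≤ 2)
    {p q r : V} (hpq : p ≠ q) (hpr : p ≠ r) (hqr : q ≠ r)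
    (hp : K.degree p ≤ 1) (hq : K.degree q ≤ 1) (hr : K.degree r ≤ 1)
    (h1 : K.Reachable p q) (h3 : K.Reachable p r) : False := by
  let C := K.connectedComponentMk p
  have hpC : p ∈ C.supp := rfl
  have hqC : q ∈ C.supp := SimpleGraph.ConnectedComponent.sound h1.symm
  have hrC : r ∈ C.supp := SimpleGraph.ConnectedComponent.sound h3.symm
  have hcon := C.connected_toSimpleGraph.card_vert_le_card_edgeSet_add_one
  have hsum := SimpleGraph.sum_degrees_eq_twice_card_edges C.toSimpleGraph
  have hdeg : ∀ v : C, C.toSimpleGraph.degree v = K.degree v.1 := by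
    intro v
    have : K.neighborSet v.1 ⊆ C.supp := by
      intro w hw
      have hv : K.connectedComponentMk v.1 = C := v.2
      have hw' : K.Adj v.1 w := hw
      have : K.connectedComponentMk w = C := by
        rw [← hv]; exact SimpleGraph.ConnectedComponent.sound hw'.reachable.symm
      exact this
    have := SimpleGraph.degree_induce_of_neighborSet_subset (G := K) (s := C.supp) (v := v) this
    convert this <;> rfl
  have hle : ∑ v : C, (C.toSimpleGraph.degree v +
      ((if v = ⟨p, hpC⟩ then 1 else 0) + (if v = ⟨q, hqC⟩ then 1 else 0) +
        (if v = ⟨r, hrC⟩ then 1 else 0))) ≤ ∑ v : C, 2 := by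
    refine Finset.sum_le_sum fun v _ => ?_
    rw [hdeg]
    have := h2 v.1
    by_cases e1 : v = ⟨p, hpC⟩
    · subst e1; simp [hpq, hpr]; omega
    · by_cases e2 : v = ⟨q, hqC⟩
      · subst e2; simp [hpq.symm, hqr]; omega
      · by_cases e3 : v = ⟨r, hrC⟩
        · subst e3; simp [hpr.symm, hqr.symm]; omega
        · simp [e1, e2, e3]; omega
  rw [Finset.sum_add_distrib, Finset.sum_add_distrib, Finset.sum_add_distrib, hsum] at hle
  simp only [Finset.sum_ite_eq', Finset.mem_univ, if_true, Finset.sum_const, Finset.card_univ,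
    smul_eq_mul] at hle
  rw [Nat.card_eq_fintype_card, Nat.card_eq_fintype_card,
    ← SimpleGraph.edgeFinset_card] at hcon
  omega

/-- A partial proper edge coloring with colors `{1,…,k}`, as a symmetric function on pairs of
vertices, the value `0` meaning that the pair is uncolored. -/
structure Proper (k : ℕ) (c : V → V → ℕ) : Prop where
  symm : ∀ u v, c u v = c v u
  le : ∀ u v, c u v ≤ k
  diag : ∀ u, c u u = 0
  inj : ∀ u v w, c u v ≠ 0 → c u v = c u w → v = w

/-- `c` properly colors all edges of `G` but `xy`. -/
structure Col (G : SimpleGraph V) (k : ℕ) (x y : V) (c : V → V → ℕ) : Prop extends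
    Proper k c where
  adj : G.Adj x y
  ne_zero_iff : ∀ u v, c u v ≠ 0 ↔ G.Adj u v ∧ s(u, v) ≠ s(x, y)

/-- The colors of `{1,…,k}` missing at `v`. -/
noncomputable def Miss (k : ℕ) (c : V → V → ℕ) (v : V) : Finset ℕ :=
  (Finset.Icc 1 k).filter (fun a => ∀ u, c v u ≠ a)

/-- The subgraph of the pairs colored `a` or `b`. -/
def kempe (c : V → V → ℕ) (a b : ℕ) : SimpleGraph V :=
  SimpleGraph.fromRel (fun u v => c u v = a ∨ c u v = b)

/-- Exchange `a` and `b` outside the `a`-`b`-component of `x`. -/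
noncomputable def offSwap (c : V → V → ℕ) (a b : ℕ) (x u v : V) : ℕ :=
  if (kempe c a b).Reachable x u then c u v else Equiv.swap a b (c u v)

/-- Give the pair `pq` the color `a`. -/
noncomputable def setEdge (c : V → V → ℕ) (p q : V) (a : ℕ) (u v : V) : ℕ :=
  if s(u, v) = s(p, q) then a else c u v

section Basic

variable {G : SimpleGraph V} {k : ℕ} {c : V → V → ℕ} {a b d : ℕ} {x y z u v w : V}

lemma mem_Miss : a ∈ Miss k c v ↔ (1 ≤ a ∧ a ≤ k) ∧ ∀ u, c v u ≠ a := by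
  simp [Miss]

lemma Miss_subset (k : ℕ) (c : V → V → ℕ) (v : V) : Miss k c v ⊆ Icc 1 k :=
  Finset.filter_subset _ _

lemma Miss.pos (h : a ∈ Miss k c v) : a ≠ 0 := by
  have := (mem_Miss.1 h).1; omega

lemma Miss.le (h : a ∈ Miss k c v) : a ≤ k := (mem_Miss.1 h).1.2

lemma Miss.ne (h : a ∈ Miss k c v) (u : V) : c v u ≠ a := (mem_Miss.1 h).2 u

lemma exists_of_not_mem_Miss (ha : a ≠ 0) (hk : a ≤ k) (h : a ∉ Miss k c v) :
    ∃ u, c v u = a := by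
  by_contra! hh
  exact h (mem_Miss.2 ⟨⟨by omega, hk⟩, hh⟩)

lemma Proper.kempe_adj (hc : Proper k c) (ha : a ≠ 0) (hb : b ≠ 0) :
    (kempe c a b).Adj u v ↔ c u v = a ∨ c u v = b := by
  unfold kempe
  rw [SimpleGraph.fromRel_adj, hc.symm v u]
  constructor
  · rintro ⟨-, h | h⟩ <;> exact h
  · intro h
    refine ⟨?_, Or.inl h⟩
    rintro rfl
    rw [hc.diag] at h
    omega

lemma Proper.degree_kempe_le [Fintype V] (hc : Proper k c) (ha : a ≠ 0) (hb : b ≠ 0) (v : V) :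
    (kempe c a b).degree v ≤ 2 := by
  rw [← SimpleGraph.card_neighborFinset_eq_degree]
  refine (Finset.card_le_card_of_injOn (c v) (t := {a, b}) ?_ ?_).trans Finset.card_le_two
  · intro u hu
    have : (kempe c a b).Adj v u := by simpa using hu
    simpa [hc.kempe_adj ha hb] using this
  · intro u hu w hw h
    have : (kempe c a b).Adj v u := by simpa using hu
    rw [hc.kempe_adj ha hb] at this
    exact hc.inj _ _ _ (by omega) h

/-- At most one color occurs on the edges of `K` at `v`. -/
def Mono (K : SimpleGraph V) (c : V → V → ℕ) (v : V) : Prop :=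
  ∃ d, ∀ u, K.Adj v u → c v u = d

lemma Proper.three [Fintype V] (hc : Proper k c) (ha : a ≠ 0) (hb : b ≠ 0) {K : SimpleGraph V}
    (hK : K ≤ kempe c a b) {p q r : V} (hpq : p ≠ q) (hpr : p ≠ r) (hqr : q ≠ r)
    (hp : Mono K c p) (hq : Mono K c q) (hr : Mono K c r)
    (h1 : K.Reachable p q) (h3 : K.Reachable p r) : False := by
  have key : ∀ v, Mono K c v → K.degree v ≤ 1 := by
    rintro v ⟨d, hd⟩
    rw [← SimpleGraph.card_neighborFinset_eq_degree, Finset.card_le_one]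
    intro u hu w hw
    have hu : K.Adj v u := by simpa using hu
    have hw : K.Adj v w := by simpa using hw
    have := (hc.kempe_adj ha hb).1 (hK hu)
    exact hc.inj v u w (by omega) ((hd u hu).trans (hd w hw).symm)
  refine not_reachable_three K (fun v => ?_) hpq hpr hqr (key _ hp) (key _ hq) (key _ hr) h1 h3
  exact (SimpleGraph.degree_le_of_le hK).trans (hc.degree_kempe_le ha hb v)

lemma Proper.mono_left (hc : Proper k c) (ha : a ∈ Miss k c v) (hb : b ≠ 0) :
    Mono (kempe c a b) c v :=
  ⟨b, fun u h => ((hc.kempe_adj (Miss.pos ha) hb).1 h).resolve_left (Miss.ne ha u)⟩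

lemma Proper.mono_right (hc : Proper k c) (ha : a ≠ 0) (hb : b ∈ Miss k c v) :
    Mono (kempe c a b) c v :=
  ⟨a, fun u h => ((hc.kempe_adj ha (Miss.pos hb)).1 h).resolve_right (Miss.ne hb u)⟩

/-- Two vertices and a third one, each missing one of `a` and `b`, do not all lie in the same
`a`-`b`-component. -/
lemma Proper.kempe_three [Fintype V] (hc : Proper k c) (ha : a ≠ 0) (hb : b ≠ 0)
    {p q r : V} (hpq : p ≠ q) (hpr : p ≠ r) (hqr : q ≠ r)
    (hp : a ∈ Miss k c p ∨ b ∈ Miss k c p) (hq : a ∈ Miss k c q ∨ b ∈ Miss k c q)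
    (hr : a ∈ Miss k c r ∨ b ∈ Miss k c r)
    (h1 : (kempe c a b).Reachable p q) : ¬ (kempe c a b).Reachable p r := by
  have key : ∀ v, (a ∈ Miss k c v ∨ b ∈ Miss k c v) → Mono (kempe c a b) c v := by
    rintro v (h | h)
    · exact hc.mono_left h hb
    · exact hc.mono_right ha h
  exact fun h3 => hc.three ha hb le_rfl hpq hpr hqr (key _ hp) (key _ hq) (key _ hr) h1 h3

lemma offSwap_of_reachable (h : (kempe c a b).Reachable x u) : offSwap c a b x u v = c u v :=
  if_pos h

lemma offSwap_of_not_reachable (h : ¬ (kempe c a b).Reachable x u) :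
    offSwap c a b x u v = Equiv.swap a b (c u v) :=
  if_neg h

lemma swap_eq_iff_of_ne {a b d e : ℕ} (h1 : d ≠ a) (h2 : d ≠ b) :
    Equiv.swap a b e = d ↔ e = d := by
  rw [← Equiv.eq_symm_apply, Equiv.symm_swap, Equiv.swap_apply_of_ne_of_ne h1 h2]

lemma offSwap_eq_iff (h1 : d ≠ a) (h2 : d ≠ b) :
    offSwap c a b x u v = d ↔ c u v = d := by
  unfold offSwap
  split_ifs
  · rfl
  · exact swap_eq_iff_of_ne h1 h2

lemma offSwap_self : offSwap c a b x x v = c x v :=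
  offSwap_of_reachable (SimpleGraph.Reachable.refl _)

lemma Proper.offSwap (hc : Proper k c) (ha : a ≠ 0) (hak : a ≤ k) (hb : b ≠ 0) (hbk : b ≤ k)
    (x : V) : Proper k (offSwap c a b x) where
  symm u v := by
    by_cases h : c u v = a ∨ c u v = b
    · have hr := ((hc.kempe_adj ha hb).2 h).reachable
      have : (kempe c a b).Reachable x u ↔ (kempe c a b).Reachable x v :=
        ⟨fun h => h.trans hr, fun h => h.trans hr.symm⟩
      unfold EdgeCol.offSwap
      rw [hc.symm v u]
      simp only [this]
    · push Not at h
      have e : EdgeCol.offSwap c a b x u v = c u v := (offSwap_eq_iff h.1 h.2).2 rfl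
      rw [e, eq_comm]
      exact (offSwap_eq_iff h.1 h.2).2 (hc.symm v u)
  le u v := by
    unfold EdgeCol.offSwap
    split_ifs
    · exact hc.le u v
    · rw [Equiv.swap_apply_def]
      have := hc.le u v
      split_ifs <;> omega
  diag u := (offSwap_eq_iff ha.symm hb.symm).2 (hc.diag u)
  inj u v w h := by
    have h0 : c u v ≠ 0 := fun e => h ((offSwap_eq_iff ha.symm hb.symm).2 e)
    unfold EdgeCol.offSwap
    split_ifs
    · exact hc.inj u v w h0
    · intro e
      exact hc.inj u v w h0 ((Equiv.swap a b).injective e)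

lemma Col.offSwap (hc : Col G k x y c) (ha : a ≠ 0) (hak : a ≤ k) (hb : b ≠ 0) (hbk : b ≤ k)
    (w : V) : Col G k x y (offSwap c a b w) where
  toProper := hc.toProper.offSwap ha hak hb hbk w
  adj := hc.adj
  ne_zero_iff u v := by
    rw [← hc.ne_zero_iff, not_iff_not]
    exact offSwap_eq_iff ha.symm hb.symm

lemma Miss_offSwap_of_reachable (h : (kempe c a b).Reachable x u) :
    Miss k (offSwap c a b x) u = Miss k c u := by
  ext d
  simp only [mem_Miss, offSwap_of_reachable h]

lemma Miss_offSwap_self : Miss k (offSwap c a b x) x = Miss k c x :=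
  Miss_offSwap_of_reachable (SimpleGraph.Reachable.refl _)

lemma mem_Miss_offSwap_of_ne (h1 : d ≠ a) (h2 : d ≠ b) :
    d ∈ Miss k (offSwap c a b x) u ↔ d ∈ Miss k c u := by
  simp only [mem_Miss, ne_eq, offSwap_eq_iff h1 h2]

lemma mem_Miss_offSwap_left (hak : a ≠ 0) (ha : a ≤ k) (h : ¬ (kempe c a b).Reachable x u)
    (hb : b ∈ Miss k c u) : a ∈ Miss k (offSwap c a b x) u := by
  refine mem_Miss.2 ⟨⟨by omega, ha⟩, fun v e => ?_⟩
  rw [offSwap_of_not_reachable h, ← Equiv.eq_symm_apply, Equiv.symm_swap,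
    Equiv.swap_apply_left] at e
  exact Miss.ne hb v e

lemma mem_Miss_offSwap_right (hbk : b ≠ 0) (hb : b ≤ k) (h : ¬ (kempe c a b).Reachable x u)
    (ha : a ∈ Miss k c u) : b ∈ Miss k (offSwap c a b x) u := by
  refine mem_Miss.2 ⟨⟨by omega, hb⟩, fun v e => ?_⟩
  rw [offSwap_of_not_reachable h, ← Equiv.eq_symm_apply, Equiv.symm_swap,
    Equiv.swap_apply_right] at e
  exact Miss.ne ha v e

lemma not_mem_Miss_offSwap_left (hbk : b ≠ 0) (hb : b ≤ k) (h : ¬ (kempe c a b).Reachable x u)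
    (hn : b ∉ Miss k c u) : a ∉ Miss k (offSwap c a b x) u := by
  obtain ⟨v, hv⟩ := exists_of_not_mem_Miss hbk hb hn
  intro hh
  apply Miss.ne hh v
  rw [offSwap_of_not_reachable h, hv, Equiv.swap_apply_right]

lemma offSwap_eq_left (h : ¬ (kempe c a b).Reachable x u) (e : c u v = b) :
    offSwap c a b x u v = a := by
  rw [offSwap_of_not_reachable h, e, Equiv.swap_apply_right]

/-! ### Recoloring one pair -/

lemma setEdge_self (c : V → V → ℕ) (p q : V) (a : ℕ) : setEdge c p q a p q = a := if_pos rfl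

lemma setEdge_of_ne {p q : V} (h : s(u, v) ≠ s(p, q)) : setEdge c p q a u v = c u v := if_neg h

lemma setEdge_comm (c : V → V → ℕ) (p q : V) (a : ℕ) : setEdge c p q a = setEdge c q p a := by
  funext u v
  rw [setEdge, setEdge, Sym2.eq_swap (a := p)]

lemma Proper.setEdge {p q : V} (hc : Proper k c) (hpq : p ≠ q) (hak : a ≤ k)
    (h : a = 0 ∨ (a ∈ Miss k c p ∧ a ∈ Miss k c q)) : Proper k (setEdge c p q a) where
  symm u v := by
    unfold EdgeCol.setEdge
    rw [hc.symm v u, Sym2.eq_swap (a := u)]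
  le u v := by
    unfold EdgeCol.setEdge
    have := hc.le u v
    split_ifs <;> assumption
  diag u := by
    rw [setEdge_of_ne, hc.diag]
    intro e
    rw [Sym2.eq_iff] at e
    rcases e with ⟨rfl, rfl⟩ | ⟨rfl, rfl⟩ <;> exact hpq rfl
  inj u v w := by
    unfold EdgeCol.setEdge
    intro h0 e
    split_ifs at h0 e with h1 h2 h2
    · rw [← h2, Sym2.eq_iff] at h1
      grind
    · exfalso
      obtain ⟨hp, hq⟩ := h.resolve_left h0
      rw [Sym2.eq_iff] at h1
      rcases h1 with ⟨rfl, rfl⟩ | ⟨rfl, rfl⟩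
      · exact Miss.ne hp _ e.symm
      · exact Miss.ne hq _ e.symm
    · exfalso
      have ha : a ≠ 0 := e ▸ h0
      obtain ⟨hp, hq⟩ := h.resolve_left ha
      rw [Sym2.eq_iff] at h2
      rcases h2 with ⟨rfl, rfl⟩ | ⟨rfl, rfl⟩
      · exact Miss.ne hp _ e
      · exact Miss.ne hq _ e
    · exact hc.inj u v w h0 e

lemma mem_Miss_setEdge_of_ne {p q : V} (hu : u ≠ p) (hu' : u ≠ q) :
    d ∈ Miss k (setEdge c p q a) u ↔ d ∈ Miss k c u := by
  have : ∀ v, setEdge c p q a u v = c u v := by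
    intro v
    apply setEdge_of_ne
    rw [ne_eq, Sym2.eq_iff]
    tauto
  simp only [mem_Miss, this]

lemma setEdge_row {p q : V} (hv : v ≠ q) (hpq : p ≠ q) : setEdge c p q a p v = c p v := by
  apply setEdge_of_ne
  rw [ne_eq, Sym2.eq_iff]
  tauto

lemma Proper.mem_Miss_setEdge {p q : V} (hc : Proper k c) (hpq : p ≠ q) (ha : c p q ≠ a) :
    d ∈ Miss k (EdgeCol.setEdge c p q a) p ↔
      d ≠ a ∧ (d ∈ Miss k c p ∨ (d = c p q ∧ d ≠ 0)) := by
  simp only [mem_Miss]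
  constructor
  · rintro ⟨h1, h2⟩
    refine ⟨fun e => h2 q (by rw [setEdge_self, e]), ?_⟩
    by_cases hd : d = c p q
    · exact Or.inr ⟨hd, by omega⟩
    · refine Or.inl ⟨h1, fun v e => ?_⟩
      by_cases hv : v = q
      · subst hv; exact hd e.symm
      · exact h2 v (by rw [setEdge_row hv hpq, e])
  · rintro ⟨h1, h2 | ⟨h2, h3⟩⟩
    · refine ⟨h2.1, fun v => ?_⟩
      by_cases hv : v = q
      · subst hv; rw [setEdge_self]; exact h1.symm
      · rw [setEdge_row hv hpq]; exact h2.2 v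
    · refine ⟨⟨by omega, by rw [h2]; exact hc.le _ _⟩, fun v e => ?_⟩
      by_cases hv : v = q
      · subst hv; rw [setEdge_self] at e; exact h1 e.symm
      · rw [setEdge_row hv hpq] at e
        exact hv (hc.inj p v q (by omega) (e.trans h2))

end Basic

end EdgeCol

namespace EdgeCol

section Moves

variable {G : SimpleGraph V} {k : ℕ} {c : V → V → ℕ} {a b d β δ : ℕ} {x y z u v w l : V}

/-- `G` has no proper edge coloring with `k` colors. -/
def Uncolorable (G : SimpleGraph V) (k : ℕ) : Prop :=
  ∀ c : V → V → ℕ, Proper k c → ¬ ∀ u v, c u v ≠ 0 ↔ G.Adj u v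

lemma Col.eq_zero (hc : Col G k x y c) : c x y = 0 := by
  by_contra h
  exact ((hc.ne_zero_iff x y).1 h).2 rfl

lemma Col.eq_zero' (hc : Col G k x y c) : c y x = 0 := by
  rw [hc.symm, hc.eq_zero]

lemma Col.ne (hc : Col G k x y c) : x ≠ y := hc.adj.ne

lemma Col.swap (hc : Col G k x y c) : Col G k y x c where
  toProper := hc.toProper
  adj := hc.adj.symm
  ne_zero_iff u v := by rw [hc.ne_zero_iff, Sym2.eq_swap (a := y)]

lemma Proper.ne_of_ne_zero (hc : Proper k c) (h : c u v ≠ 0) : u ≠ v := by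
  rintro rfl
  exact h (hc.diag u)

lemma Col.not_mem_Miss (hno : Uncolorable G k) (hc : Col G k x y c) (h : a ∈ Miss k c x) :
    a ∉ Miss k c y := by
  intro h'
  refine hno _ (hc.toProper.setEdge hc.ne (Miss.le h) (Or.inr ⟨h, h'⟩)) fun u v => ?_
  by_cases e : s(u, v) = s(x, y)
  · have : G.Adj u v := by
      rw [← SimpleGraph.mem_edgeSet, e]
      exact hc.adj
    rw [setEdge, if_pos e]
    exact iff_of_true (Miss.pos h) this
  · rw [setEdge_of_ne e, hc.ne_zero_iff]
    tauto

lemma Col.linked (hno : Uncolorable G k) (hc : Col G k x y c) (ha : a ∈ Miss k c x)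
    (hb : b ∈ Miss k c y) : (kempe c a b).Reachable x y := by
  by_contra h
  refine (hc.offSwap (Miss.pos ha) (Miss.le ha) (Miss.pos hb) (Miss.le hb) x).not_mem_Miss hno
    (a := a) ?_ (mem_Miss_offSwap_left (Miss.pos ha) (Miss.le ha) h hb)
  rwa [Miss_offSwap_self]

/-! ### Shifting the uncolored edge -/

/-- Move the color of `xz` to `xy`, leaving `xz` uncolored. -/
noncomputable def shift (c : V → V → ℕ) (x y z : V) : V → V → ℕ :=
  setEdge (setEdge c x z 0) x y (c x z)

lemma shift_of_ne (h1 : s(u, v) ≠ s(x, y)) (h2 : s(u, v) ≠ s(x, z)) :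
    shift c x y z u v = c u v := by
  rw [shift, setEdge_of_ne h1, setEdge_of_ne h2]

lemma shift_of_ne_of_ne (hx : u ≠ x) (hx' : v ≠ x) : shift c x y z u v = c u v := by
  apply shift_of_ne <;> rw [ne_eq, Sym2.eq_iff] <;> tauto

lemma shift_left : shift c x y z x y = c x z := setEdge_self _ _ _ _

lemma Col.ne_of_mem (hc : Col G k x y c) (hz : c x z ∈ Miss k c y) : z ≠ y := by
  rintro rfl
  exact Miss.pos hz hc.eq_zero

lemma Col.ne_left (hc : Col G k x y c) (hz : c x z ∈ Miss k c y) : x ≠ z :=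
  hc.ne_of_ne_zero (Miss.pos hz)

lemma Col.mem_Miss_shift_left (hc : Col G k x y c) (hz : c x z ∈ Miss k c y) :
    d ∈ Miss k (shift c x y z) x ↔ d ∈ Miss k c x := by
  have h0 := Miss.pos hz
  have h1 : setEdge c x z 0 x y = 0 := by
    rw [setEdge_row (hc.ne_of_mem hz).symm (hc.ne_left hz), hc.eq_zero]
  rw [shift, (hc.toProper.setEdge (hc.ne_left hz) (Nat.zero_le k) (Or.inl rfl)).mem_Miss_setEdge
    hc.ne (by omega), hc.toProper.mem_Miss_setEdge (hc.ne_left hz) h0, h1]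
  constructor
  · rintro ⟨h2, ⟨-, h3 | h3⟩ | h3⟩
    · exact h3
    · exact absurd h3.1 h2
    · omega
  · intro h
    exact ⟨(Miss.ne h z).symm, Or.inl ⟨Miss.pos h, Or.inl h⟩⟩

lemma Col.mem_Miss_shift_new (hc : Col G k x y c) (hz : c x z ∈ Miss k c y) :
    d ∈ Miss k (shift c x y z) z ↔ d = c x z ∨ d ∈ Miss k c z := by
  have h0 := Miss.pos hz
  have h1 := hc.symm x z
  rw [shift, mem_Miss_setEdge_of_ne (hc.ne_left hz).symm (hc.ne_of_mem hz), setEdge_comm,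
    hc.toProper.mem_Miss_setEdge (hc.ne_left hz).symm (by omega), ← h1]
  constructor
  · rintro ⟨h2, h3 | h3⟩
    · exact Or.inr h3
    · exact Or.inl h3.1
  · rintro (rfl | h3)
    · exact ⟨h0, Or.inr ⟨rfl, h0⟩⟩
    · exact ⟨Miss.pos h3, Or.inl h3⟩

lemma mem_Miss_shift_of_ne (hx : u ≠ x) (hy : u ≠ y) (hz : u ≠ z) :
    d ∈ Miss k (shift c x y z) u ↔ d ∈ Miss k c u := by
  rw [shift, mem_Miss_setEdge_of_ne hx hy, mem_Miss_setEdge_of_ne hx hz]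

lemma Col.shift (hc : Col G k x y c) (hz : c x z ∈ Miss k c y) :
    Col G k x z (shift c x y z) where
  toProper := by
    refine (hc.toProper.setEdge (hc.ne_left hz) (Nat.zero_le k) (Or.inl rfl)).setEdge hc.ne
      (hc.le _ _) (Or.inr ⟨?_, ?_⟩)
    · rw [hc.toProper.mem_Miss_setEdge (hc.ne_left hz) (Miss.pos hz)]
      exact ⟨Miss.pos hz, Or.inr ⟨rfl, Miss.pos hz⟩⟩
    · rwa [mem_Miss_setEdge_of_ne hc.ne.symm (hc.ne_of_mem hz).symm]
  adj := ((hc.ne_zero_iff x z).1 (Miss.pos hz)).1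
  ne_zero_iff u v := by
    by_cases h1 : s(u, v) = s(x, y)
    · have h2 : s(x, y) ≠ s(x, z) := by
        have := hc.ne_of_mem hz
        rw [ne_eq, Sym2.eq_iff]
        grind
      have h3 : G.Adj u v := by
        rw [← SimpleGraph.mem_edgeSet, h1]
        exact hc.adj
      rw [EdgeCol.shift, EdgeCol.setEdge, if_pos h1, h1]
      exact iff_of_true (Miss.pos hz) ⟨h3, h2⟩
    · rw [EdgeCol.shift, setEdge_of_ne h1]
      by_cases h2 : s(u, v) = s(x, z)
      · rw [EdgeCol.setEdge, if_pos h2]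
        tauto
      · rw [setEdge_of_ne h2, hc.ne_zero_iff]
        tauto

lemma Col.kempe_shift (hc : Col G k x y c) (hz : c x z ∈ Miss k c y) (ha : a ≠ 0) (hb : b ≠ 0)
    (ha' : c x z ≠ a) (hb' : c x z ≠ b) : kempe (EdgeCol.shift c x y z) a b = kempe c a b := by
  ext u v
  rw [(hc.shift hz).kempe_adj ha hb, hc.kempe_adj ha hb]
  have e : ∀ d, d ≠ 0 → c x z ≠ d → (EdgeCol.shift c x y z u v = d ↔ c u v = d) := by
    intro d hd hd'
    by_cases h1 : s(u, v) = s(x, y)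
    · rw [EdgeCol.shift, EdgeCol.setEdge, if_pos h1]
      refine iff_of_false hd' fun e => ?_
      exact ((hc.ne_zero_iff u v).1 (by omega)).2 h1
    · by_cases h2 : s(u, v) = s(x, z)
      · have h3 : c u v = c x z := by
          rw [Sym2.eq_iff] at h2
          rcases h2 with ⟨rfl, rfl⟩ | ⟨rfl, rfl⟩
          · rfl
          · exact hc.symm _ _
        rw [EdgeCol.shift, setEdge_of_ne h1, EdgeCol.setEdge, if_pos h2, h3]
        exact iff_of_false hd.symm hd'
      · rw [shift_of_ne h1 h2]
  rw [e a ha ha', e b hb hb']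

lemma Col.Miss_shift_left (hc : Col G k x y c) (hz : c x z ∈ Miss k c y) :
    Miss k (EdgeCol.shift c x y z) x = Miss k c x := by
  ext d
  exact hc.mem_Miss_shift_left hz

/-! ### Fans and paths at the uncolored edge -/

lemma Col.fan_left (hno : Uncolorable G k) (hc : Col G k x y c) (hz : c x z ∈ Miss k c y)
    (ha : a ∈ Miss k c x) : a ∉ Miss k c z := by
  intro h
  exact (hc.shift hz).not_mem_Miss hno ((hc.mem_Miss_shift_left hz).2 ha)
    ((hc.mem_Miss_shift_new hz).2 (Or.inr h))

lemma Col.fan_right [Fintype V] (hno : Uncolorable G k) (hc : Col G k x y c)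
    (hz : c x z ∈ Miss k c y) (hX : (Miss k c x).Nonempty)
    (hd : d ∈ Miss k c y) : d ∉ Miss k c z := by
  intro h
  obtain ⟨a, ha⟩ := hX
  have h1 := hc.linked hno ha hd
  have h2 := (hc.shift hz).linked hno ((hc.mem_Miss_shift_left hz).2 ha)
    ((hc.mem_Miss_shift_new hz).2 (Or.inr h))
  rw [hc.kempe_shift hz (Miss.pos ha) (Miss.pos hd) (Miss.ne ha z)
    (by rw [hc.symm]; exact Miss.ne h x)] at h2
  exact hc.kempe_three (Miss.pos ha) (Miss.pos hd) hc.ne (hc.ne_left hz) (hc.ne_of_mem hz).symm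
    (Or.inl ha) (Or.inr hd) (Or.inr h) h1 h2

lemma Col.path_aux [Fintype V] (hno : Uncolorable G k) (hc : Col G k x y c)
    (hz : c x z ∈ Miss k c y) (hw : c z w ∈ Miss k c x) (hwx : w ≠ x)
    (ha : a ∈ Miss k c x) : a ∉ Miss k c w := by
  intro h
  by_cases hwy : w = y
  · subst hwy
    exact hc.not_mem_Miss hno ha h
  have hzw := hc.ne_of_ne_zero (Miss.pos hw)
  have h1 := (hc.shift hz).swap
  have e : EdgeCol.shift c x y z z w = c z w := shift_of_ne_of_ne (hc.ne_left hz).symm hwx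
  refine h1.fan_right hno (z := w) ?_ ⟨c x z, (hc.mem_Miss_shift_new hz).2 (Or.inl rfl)⟩
    ((hc.mem_Miss_shift_left hz).2 ha) ?_
  · rw [e]
    exact (hc.mem_Miss_shift_left hz).2 hw
  · rwa [mem_Miss_shift_of_ne hwx hwy hzw.symm]

lemma Col.path [Fintype V] (hno : Uncolorable G k) (hc : Col G k x y c)
    (hX : 2 ≤ #(Miss k c x))
    (hz : c x z ∈ Miss k c y) (hw : c z w ∈ Miss k c x ∨ c z w ∈ Miss k c y) (hwx : w ≠ x)
    (ha : a ∈ Miss k c x) : a ∉ Miss k c w := by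
  intro h
  rcases hw with hw | hw
  · exact hc.path_aux hno hz hw hwx ha h
  set δ := c z w with hδ
  have hwy : w ≠ y := by
    rintro rfl
    exact Miss.ne hw z (hc.symm _ _)
  have haδ : a ≠ δ := fun e => hc.not_mem_Miss hno ha (e ▸ hw)
  obtain ⟨b, hb, hba⟩ := Finset.exists_mem_ne (by omega : 1 < #(Miss k c x)) a
  have hbδ : b ≠ δ := fun e => hc.not_mem_Miss hno hb (e ▸ hw)
  have hxy := hc.linked hno ha hw
  have hxw := hc.kempe_three (Miss.pos ha) (Miss.pos hw) hc.ne hwx.symm hwy.symm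
    (Or.inl ha) (Or.inr hw) (Or.inl h) hxy
  have hc1 := hc.offSwap (Miss.pos ha) (Miss.le ha) (Miss.pos hw) (Miss.le hw) x
  set c1 := EdgeCol.offSwap c a δ x with hc1d
  have hzw1 : c1 z w = a := by
    rw [hc1.symm]
    exact offSwap_eq_left hxw ((hc.symm _ _).trans hδ.symm)
  have hX1 : Miss k c1 x = Miss k c x := Miss_offSwap_self
  have hY1 : Miss k c1 y = Miss k c y := Miss_offSwap_of_reachable hxy
  have hw1 : δ ∈ Miss k c1 w := mem_Miss_offSwap_right (Miss.pos hw) (Miss.le hw) hxw h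
  have hxz1 : c1 x z = c x z := offSwap_self
  have hb1 := hX1.symm ▸ hb
  have hδ1 := hY1.symm ▸ hw
  have hxy1 := hc1.linked hno hb1 hδ1
  have hxw1 := hc1.kempe_three (Miss.pos hb) (Miss.pos hw) hc.ne hwx.symm hwy.symm
    (Or.inl hb1) (Or.inr hδ1) (Or.inr hw1) hxy1
  have hc2 := hc1.offSwap (Miss.pos hb) (Miss.le hb) (Miss.pos hw) (Miss.le hw) x
  refine hc2.path_aux hno (z := z) (w := w) (a := b) ?_ ?_ hwx ?_
    (mem_Miss_offSwap_left (Miss.pos hb) (Miss.le hb) hxw1 hw1)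
  · rw [offSwap_self, Miss_offSwap_of_reachable hxy1, hY1, hxz1]
    exact hz
  · rw [Miss_offSwap_self, hX1, (offSwap_eq_iff hba.symm haδ).2 hzw1]
    exact ha
  · rwa [Miss_offSwap_self]

lemma Col.shifted_path [Fintype V] (hno : Uncolorable G k) (hc : Col G k x y c)
    (hX : 2 ≤ #(Miss k c x))
    (hz : c x z ∈ Miss k c y) (hl : c y l ∈ Miss k c z)
    (ha : a ∈ Miss k c x) : a ∉ Miss k c l := by
  intro h
  have hlx : l ≠ x := by
    rintro rfl
    exact Miss.pos hl hc.eq_zero'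
  have hlz : l ≠ z := by
    rintro rfl
    exact Miss.ne hl y (hc.symm _ _)
  have hly := hc.ne_of_ne_zero (Miss.pos hl)
  refine (hc.shift hz).path hno (z := y) (w := l) (a := a) ?_ ?_ ?_ hlx ?_ ?_
  · rwa [hc.Miss_shift_left hz]
  · rw [shift_left]
    exact (hc.mem_Miss_shift_new hz).2 (Or.inl rfl)
  · rw [shift_of_ne_of_ne hc.ne.symm hlx]
    exact Or.inr ((hc.mem_Miss_shift_new hz).2 (Or.inr hl))
  · rwa [hc.Miss_shift_left hz]
  · rwa [mem_Miss_shift_of_ne hlx hly.symm hlz]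

/-! ### Counting missing colors -/

lemma Proper.card_Miss [Fintype V] (hc : Proper k c) (u : V) :
    #(Miss k c u) + #(univ.filter fun w => c u w ≠ 0) = k := by
  have h : #(univ.filter fun w => c u w ≠ 0) =
      #((Icc 1 k).filter fun a => ¬ ∀ w, c u w ≠ a) := by
    refine Finset.card_bij (fun w _ => c u w) ?_ ?_ ?_
    · intro w hw
      have hw : c u w ≠ 0 := by simpa using hw
      have := hc.le u w
      simp only [mem_filter, mem_Icc, not_forall, not_not]
      exact ⟨by omega, w, rfl⟩
    · intro w hw w' _ e
      exact hc.inj u w w' (by simpa using hw) e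
    · intro a ha
      simp only [mem_filter, mem_Icc, not_forall, not_not] at ha
      obtain ⟨ha, w, hw⟩ := ha
      exact ⟨w, by simp; omega, hw⟩
  rw [h, Miss, Finset.card_filter_add_card_filter_not, Nat.card_Icc]
  omega

lemma Col.card_Miss_left [Fintype V] (hc : Col G k x y c) :
    #(Miss k c x) + G.degree x = k + 1 := by
  have h := hc.toProper.card_Miss x
  have e : (univ.filter fun w => c x w ≠ 0) = (G.neighborFinset x).erase y := by
    ext w
    simp only [mem_filter, mem_univ, true_and, mem_erase, SimpleGraph.mem_neighborFinset,
      hc.ne_zero_iff, ne_eq, Sym2.eq_iff]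
    have := hc.ne
    grind
  have hy : y ∈ G.neighborFinset x := by simpa using hc.adj
  have := Finset.card_pos.2 ⟨y, hy⟩
  rw [e, Finset.card_erase_of_mem hy] at h
  rw [← SimpleGraph.card_neighborFinset_eq_degree]
  omega

lemma Col.card_Miss_right [Fintype V] (hc : Col G k x y c) :
    #(Miss k c y) + G.degree y = k + 1 := hc.swap.card_Miss_left

lemma Col.card_Miss_of_ne [Fintype V] (hc : Col G k x y c) (hx : u ≠ x) (hy : u ≠ y) :
    #(Miss k c u) + G.degree u = k := by
  have h := hc.toProper.card_Miss u
  have e : (univ.filter fun w => c u w ≠ 0) = G.neighborFinset u := by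
    ext w
    simp only [mem_filter, mem_univ, true_and, SimpleGraph.mem_neighborFinset,
      hc.ne_zero_iff, ne_eq, Sym2.eq_iff]
    grind
  rw [e, SimpleGraph.card_neighborFinset_eq_degree] at h
  exact h

lemma Col.card_Miss_ge [Fintype V] (hc : Col G k x y c) (hx : u ≠ x) :
    k ≤ #(Miss k c u) + G.degree u := by
  by_cases h : u = y
  · subst h
    have := hc.card_Miss_right
    omega
  · exact (hc.card_Miss_of_ne hx h).ge

end Moves

end EdgeCol

namespace EdgeCol

/-- `u ≠ x` has degree less than `k - d(x) / 2 - 2`. -/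
structure Low (G : SimpleGraph V) [Fintype V] (k : ℕ) (x u : V) : Prop where
  ne : u ≠ x
  deg_le : 2 * G.degree u + G.degree x + 5 ≤ 2 * k

lemma reachable_deleteEdges_or {K : SimpleGraph V} {x z w v : V} (h : K.Reachable x v) :
    (K.deleteEdges {s(z, w)}).Reachable x v ∨ (K.deleteEdges {s(z, w)}).Reachable x z ∨
      (K.deleteEdges {s(z, w)}).Reachable x w := by
  rw [SimpleGraph.reachable_iff_reflTransGen] at h
  induction h with
  | refl => exact Or.inl (SimpleGraph.Reachable.refl _)
  | @tail u v _ huv ih =>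
    rcases ih with ih | ih
    · by_cases e : s(u, v) = s(z, w)
      · rw [Sym2.eq_iff] at e
        rcases e with ⟨rfl, rfl⟩ | ⟨rfl, rfl⟩
        · exact Or.inr (Or.inl ih)
        · exact Or.inr (Or.inr ih)
      · refine Or.inl (ih.trans (SimpleGraph.Adj.reachable ?_))
        rw [SimpleGraph.deleteEdges_adj]
        exact ⟨huv, by simpa using e⟩
    · exact Or.inr ih

section Pairs

variable {G : SimpleGraph V} {k : ℕ} {c : V → V → ℕ} {a a' b d e e' α β γ δ δ' : ℕ}
  {x y z u u' v w l : V}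

lemma Col.exists_common [Fintype V] (hc : Col G k x y c) (hu : Low G k x u) (hu' : Low G k x u')
    {S F : Finset ℕ} (hS : S ⊆ Icc 1 k) (hSk : k + 1 ≤ #S + G.degree x)
    (h : #(Miss k c u ∩ S) + #(Miss k c u' ∩ S) + #F ≤ 5) :
    ∃ γ ∈ Miss k c u, γ ∈ Miss k c u' ∧ γ ∉ S ∧ γ ∉ F := by
  have h1 := hc.card_Miss_ge hu.ne
  have h2 := hc.card_Miss_ge hu'.ne
  have h3 := hu.deg_le
  have h4 := hu'.deg_le
  have h5 := Finset.card_sdiff_add_card_inter (Miss k c u) S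
  have h6 := Finset.card_sdiff_add_card_inter (Miss k c u') S
  have h7 : #((Miss k c u \ S) ∪ (Miss k c u' \ S)) ≤ #(Icc 1 k \ S) := by
    refine Finset.card_le_card (Finset.union_subset ?_ ?_) <;>
    exact Finset.sdiff_subset_sdiff (Miss_subset _ _ _) le_rfl
  have h8 := Finset.card_sdiff_add_card_inter (Icc 1 k) S
  rw [Finset.inter_eq_right.2 hS, Nat.card_Icc] at h8
  have h9 := Finset.card_union_add_card_inter (Miss k c u \ S) (Miss k c u' \ S)
  obtain ⟨γ, hγ, hF⟩ := Finset.exists_mem_notMem_of_card_lt_card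
    (s := F) (t := (Miss k c u \ S) ∩ (Miss k c u' \ S)) (by omega)
  simp only [mem_inter, mem_sdiff] at hγ
  exact ⟨γ, hγ.1.1, hγ.2.1, hγ.1.2, hF⟩

lemma Col.Miss_offSwap_keep (hno : Uncolorable G k) (hc : Col G k x y c) (ha : a ∈ Miss k c x)
    (hb : b ∈ Miss k c y) : b ∈ Miss k (EdgeCol.offSwap c a γ x) y := by
  have hab : b ≠ a := fun e => hc.not_mem_Miss hno ha (e ▸ hb)
  by_cases h : b = γ
  · subst h
    rwa [Miss_offSwap_of_reachable (hc.linked hno ha hb)]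
  · rwa [mem_Miss_offSwap_of_ne hab h]

lemma Col.fan_keep (hno : Uncolorable G k) (hc : Col G k x y c) (hz : c x z ∈ Miss k c y)
    (ha : a ∈ Miss k c x) :
    EdgeCol.offSwap c a γ x x z ∈ Miss k (EdgeCol.offSwap c a γ x) y := by
  rw [offSwap_self]
  exact hc.Miss_offSwap_keep hno ha hz

lemma Col.setEdge {p q : V} (hc : Col G k x y c) (hpq : c p q ≠ 0) (hp : a ∈ Miss k c p)
    (hq : a ∈ Miss k c q) : Col G k x y (EdgeCol.setEdge c p q a) where
  toProper := hc.toProper.setEdge (hc.ne_of_ne_zero hpq) (Miss.le hp) (Or.inr ⟨hp, hq⟩)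
  adj := hc.adj
  ne_zero_iff u v := by
    rw [← hc.ne_zero_iff]
    by_cases h : s(u, v) = s(p, q)
    · rw [EdgeCol.setEdge, if_pos h]
      refine iff_of_true (Miss.pos hp) ?_
      rw [hc.ne_zero_iff] at hpq ⊢
      rw [← SimpleGraph.mem_edgeSet, h]
      exact hpq
    · rw [setEdge_of_ne h]

/-- A vertex at the end of a short alternating path from the uncolored edge. -/
def Stuck (k : ℕ) (c : V → V → ℕ) (x y z u : V) (δ : ℕ) : Prop :=
  (c z u = δ ∧ (δ ∈ Miss k c x ∨ δ ∈ Miss k c y)) ∨ (c y u = δ ∧ (δ ∈ Miss k c z ∨ δ ∈ Miss k c x))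

lemma Stuck.not_mem_Miss [Fintype V] (hno : Uncolorable G k) (hc : Col G k x y c)
    (hX : 2 ≤ #(Miss k c x))
    (hz : c x z ∈ Miss k c y) (hu : u ≠ x) (hs : Stuck k c x y z u δ) (ha : a ∈ Miss k c x) :
    a ∉ Miss k c u := by
  rcases hs with ⟨rfl, h⟩ | ⟨rfl, h | h⟩
  · exact hc.path hno hX hz h hu ha
  · exact hc.shifted_path hno hX hz h ha
  · exact hc.swap.fan_right hno h ⟨_, hz⟩ ha

lemma Stuck.ne (hc : Col G k x y c) (hs : Stuck k c x y z u δ) (h : γ ∈ Miss k c u) : γ ≠ δ := by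
  rintro rfl
  rcases hs with ⟨e, -⟩ | ⟨e, -⟩
  · exact Miss.ne h z ((hc.symm _ _).trans e)
  · exact Miss.ne h y ((hc.symm _ _).trans e)

lemma Stuck.reachable [Fintype V] (hno : Uncolorable G k) (hc : Col G k x y c)
    (hX : 2 ≤ #(Miss k c x))
    (hz : c x z ∈ Miss k c y) (hu : u ≠ x) (hs : Stuck k c x y z u δ) (ha : a ∈ Miss k c x)
    (haδ : a ≠ δ) (hγ : γ ∈ Miss k c u) : (kempe c a γ).Reachable x u := by
  by_contra h
  have hc' := hc.offSwap (Miss.pos ha) (Miss.le ha) (Miss.pos hγ) (Miss.le hγ) x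
  have hγδ := hs.ne hc hγ
  refine Stuck.not_mem_Miss hno hc' (z := z) (u := u) (δ := δ) (a := a) ?_
    (hc.fan_keep hno hz ha) hu ?_ ?_ (mem_Miss_offSwap_left (Miss.pos ha) (Miss.le ha) h hγ)
  · rwa [Miss_offSwap_self]
  · unfold Stuck at hs ⊢
    rwa [offSwap_eq_iff haδ.symm hγδ.symm, offSwap_eq_iff haδ.symm hγδ.symm,
      mem_Miss_offSwap_of_ne haδ.symm hγδ.symm, mem_Miss_offSwap_of_ne haδ.symm hγδ.symm,
      mem_Miss_offSwap_of_ne haδ.symm hγδ.symm]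
  · rwa [Miss_offSwap_self]

lemma Stuck.unique [Fintype V] (hno : Uncolorable G k) (hc : Col G k x y c) (hX : 3 ≤ #(Miss k c x))
    (hz : c x z ∈ Miss k c y) (hu : Low G k x u) (hu' : Low G k x u')
    (hs : Stuck k c x y z u δ) (hs' : Stuck k c x y z u' δ') : u = u' := by
  by_contra hne
  have e1 : Miss k c u ∩ Miss k c x = ∅ := by
    rw [← Finset.disjoint_iff_inter_eq_empty, Finset.disjoint_right]
    exact fun a ha => hs.not_mem_Miss hno hc (by omega) hz hu.ne ha
  have e2 : Miss k c u' ∩ Miss k c x = ∅ := by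
    rw [← Finset.disjoint_iff_inter_eq_empty, Finset.disjoint_right]
    exact fun a ha => hs'.not_mem_Miss hno hc (by omega) hz hu'.ne ha
  obtain ⟨γ, h1, h2, -⟩ := hc.exists_common hu hu' (S := Miss k c x) (F := ∅)
    (Miss_subset _ _ _) hc.card_Miss_left.ge (by simp [e1, e2])
  obtain ⟨a, ha, hF⟩ := Finset.exists_mem_notMem_of_card_lt_card
    (s := {δ, δ'}) (t := Miss k c x) (Finset.card_le_two.trans_lt hX)
  simp only [mem_insert, mem_singleton, not_or] at hF
  exact hc.kempe_three (Miss.pos ha) (Miss.pos h1) hu.ne.symm hu'.ne.symm hne (Or.inl ha)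
    (Or.inr h1) (Or.inr h2) (hs.reachable hno hc (by omega) hz hu.ne ha hF.1 h1)
    (hs'.reachable hno hc (by omega) hz hu'.ne ha hF.2 h2)

/-- The edges `yl` and `zw` have the same color `δ`. -/
structure Pair (c : V → V → ℕ) (x y z l w : V) (δ : ℕ) : Prop where
  ne_zero : δ ≠ 0
  left : c y l = δ
  right : c z w = δ
  ne_left : l ≠ x
  ne_right : w ≠ x

lemma Pair.ne (hP : Pair c x y z l w δ) (hc : Col G k x y c) (hz : c x z ∈ Miss k c y) :
    l ≠ w := by
  rintro rfl
  refine hc.ne_of_mem hz (hc.inj l z y ?_ ?_)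
  · rw [hc.symm, hP.right]; exact hP.ne_zero
  · rw [hc.symm, hP.right, hc.symm, hP.left]

lemma Pair.ne_of_mem (hP : Pair c x y z l w δ) (hβ : β ∈ Miss k c y) :
    δ ≠ β := by
  rintro rfl
  exact Miss.ne hβ l hP.left

lemma Pair.not_mem [Fintype V] (hP : Pair c x y z l w δ) (hno : Uncolorable G k)
    (hc : Col G k x y c)
    (hX : 2 ≤ #(Miss k c x)) (hz : c x z ∈ Miss k c y) (ha : a ∈ Miss k c x)
    (haw : a ∈ Miss k c w) : δ ∉ Miss k c x := fun h =>
  hc.path hno hX hz (Or.inl (by rwa [hP.right])) hP.ne_right ha haw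

lemma Pair.offSwap (hP : Pair c x y z l w δ) (h1 : δ ≠ a) (h2 : δ ≠ b) :
    Pair (offSwap c a b x) x y z l w δ where
  ne_zero := hP.ne_zero
  left := (offSwap_eq_iff h1 h2).2 hP.left
  right := (offSwap_eq_iff h1 h2).2 hP.right
  ne_left := hP.ne_left
  ne_right := hP.ne_right

lemma Pair.eq_of_mem [Fintype V] (hP : Pair c x y z l w δ) (hno : Uncolorable G k)
    (hc : Col G k x y c)
    (hX : 2 ≤ #(Miss k c x)) (hz : c x z ∈ Miss k c y)
    (ha : a ∈ Miss k c x) (haw : a ∈ Miss k c w) (hal : a ∈ Miss k c l)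
    (hb : b ∈ Miss k c x) (hbw : b ∈ Miss k c w) (hba : b ≠ a)
    (he : e ∈ Miss k c x) (hel : e ∈ Miss k c l) : e = a := by
  by_contra hea
  have hδ := hP.not_mem hno hc hX hz ha haw
  have hδb : b ≠ δ := fun h => hδ (h ▸ hb)
  have hδe : e ≠ δ := fun h => hδ (h ▸ he)
  have hδk : δ ≤ k := hP.left ▸ hc.le _ _
  have hc' := hc.offSwap (Miss.pos ha) (Miss.le ha) hP.ne_zero hδk x
  have hz' := hc.fan_keep (γ := δ) hno hz ha
  have hX' : Miss k (EdgeCol.offSwap c a δ x) x = Miss k c x := Miss_offSwap_self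
  by_cases hr : (kempe c a δ).Reachable x w
  · have hr' := hc.kempe_three (Miss.pos ha) hP.ne_zero hP.ne_right.symm hP.ne_left.symm
      (hP.ne hc hz).symm (Or.inl ha) (Or.inl haw) (Or.inl hal) hr
    refine hc'.swap.fan_right hno (z := l) (d := e) ?_ ⟨_, hz'⟩ (by rwa [hX'])
      ((mem_Miss_offSwap_of_ne hea hδe).2 hel)
    rw [hX', hc'.symm, offSwap_eq_left hr' (by rw [hc.symm, hP.left])]
    exact ha
  · refine hc'.path hno (w := w) (a := b) (by rwa [hX']) hz' ?_ hP.ne_right (by rwa [hX'])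
      ((mem_Miss_offSwap_of_ne hba hδb).2 hbw)
    rw [hX', hc'.symm, offSwap_eq_left hr (by rw [hc.symm, hP.right])]
    exact Or.inl ha

lemma Pair.reachable_setEdge [Fintype V] (hP : Pair c x y z l w δ) (hno : Uncolorable G k)
    (hc : Col G k x y c) (hX : 2 ≤ #(Miss k c x)) (hz : c x z ∈ Miss k c y)
    (hβ : c x z ∈ Miss k c l) (he : e ∈ Miss k c x) (hel : e ∈ Miss k c l)
    (ha : a ∈ Miss k c x) (haw : a ∈ Miss k c w) (hb : b ∈ Miss k c x)
    (hae : a ≠ e) (hba : b ≠ a) (hbe : b ≠ e) :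
    (kempe (EdgeCol.setEdge c y l (c x z)) b δ).Reachable x z := by
  by_contra hr
  set β := c x z with hβd
  have hδ := hP.not_mem hno hc hX hz ha haw
  have hδa : a ≠ δ := fun h => hδ (h ▸ ha)
  have hδb : b ≠ δ := fun h => hδ (h ▸ hb)
  have hδe : e ≠ δ := fun h => hδ (h ▸ he)
  have hδβ : δ ≠ β := hP.ne_of_mem hz
  have hβb : β ≠ b := Miss.ne hb z
  have hβe : β ≠ e := Miss.ne he z
  have hδk : δ ≤ k := hP.left ▸ hc.le _ _
  have hyl : y ≠ l := hc.ne_of_ne_zero (by rw [hP.left]; exact hP.ne_zero)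
  have hlw := hP.ne hc hz
  have hwy : w ≠ y := by
    rintro rfl
    exact hc.not_mem_Miss hno ha haw
  have hxy := hc.ne
  have hxl := hP.ne_left.symm
  have hzy := hc.ne_of_mem hz
  have hc1 : Col G k x y (EdgeCol.setEdge c y l β) :=
    hc.setEdge (by rw [hP.left]; exact hP.ne_zero) hz hβ
  have hM1 : ∀ {d v}, v ≠ y → v ≠ l →
      (d ∈ Miss k (EdgeCol.setEdge c y l β) v ↔ d ∈ Miss k c v) :=
    fun h h' => mem_Miss_setEdge_of_ne h h'
  have hyδ1 : δ ∈ Miss k (EdgeCol.setEdge c y l β) y := by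
    rw [hc.toProper.mem_Miss_setEdge hyl (by rwa [hP.left])]
    exact ⟨hδβ, Or.inr ⟨hP.left.symm, hP.ne_zero⟩⟩
  have hel1 : e ∈ Miss k (EdgeCol.setEdge c y l β) l := by
    rw [setEdge_comm, hc.toProper.mem_Miss_setEdge hyl.symm (by rwa [hc.symm, hP.left])]
    exact ⟨hβe.symm, Or.inl hel⟩
  have hzw1 : EdgeCol.setEdge c y l β z w = δ := by
    rw [setEdge_of_ne, hP.right]
    rw [ne_eq, Sym2.eq_iff]
    tauto
  have hxz1 : EdgeCol.setEdge c y l β x z = β := by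
    rw [setEdge_of_ne, hβd]
    rw [ne_eq, Sym2.eq_iff]
    tauto
  have hyl1 : EdgeCol.setEdge c y l β y l = β := setEdge_self _ _ _ _
  have hb1 := (hM1 hxy hxl).2 hb
  have ha1 := (hM1 hxy hxl).2 ha
  have he1 := (hM1 hxy hxl).2 he
  have haw1 := (hM1 hwy hlw.symm).2 haw
  clear hM1
  generalize EdgeCol.setEdge c y l β = c1 at *
  have hxy1 := hc1.linked hno hb1 hyδ1
  have hc2 := hc1.offSwap (Miss.pos hb) (Miss.le hb) hP.ne_zero hδk x
  have hX2 : Miss k (EdgeCol.offSwap c1 b δ x) x = Miss k c1 x := Miss_offSwap_self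
  have hyδ2 : δ ∈ Miss k (EdgeCol.offSwap c1 b δ x) y := by
    rwa [Miss_offSwap_of_reachable hxy1]
  have hzw2 : EdgeCol.offSwap c1 b δ x z w = b := offSwap_eq_left hr hzw1
  have haw2 : a ∈ Miss k (EdgeCol.offSwap c1 b δ x) w :=
    (mem_Miss_offSwap_of_ne hba.symm hδa).2 haw1
  have hel2 : e ∈ Miss k (EdgeCol.offSwap c1 b δ x) l :=
    (mem_Miss_offSwap_of_ne hbe.symm hδe).2 hel1
  have hyl2 : EdgeCol.offSwap c1 b δ x y l = β := (offSwap_eq_iff hβb hδβ.symm).2 hyl1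
  have hxz2 : EdgeCol.offSwap c1 b δ x x z = β := (offSwap_eq_iff hβb hδβ.symm).2 hxz1
  rw [← hX2] at hb1 ha1 he1
  clear hX2
  generalize EdgeCol.offSwap c1 b δ x = c2 at *
  have hxy2 := hc2.linked hno he1 hyδ2
  have hxl2 := hc2.kempe_three (Miss.pos he) hP.ne_zero hxy hxl hyl (Or.inl he1)
    (Or.inr hyδ2) (Or.inl hel2) hxy2
  have hc3 := hc2.offSwap (Miss.pos he) (Miss.le he) hP.ne_zero hδk x
  have hX3 : Miss k (EdgeCol.offSwap c2 e δ x) x = Miss k c2 x := Miss_offSwap_self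
  have hyδ3 : δ ∈ Miss k (EdgeCol.offSwap c2 e δ x) y := by
    rwa [Miss_offSwap_of_reachable hxy2]
  have hlδ3 : δ ∈ Miss k (EdgeCol.offSwap c2 e δ x) l :=
    mem_Miss_offSwap_right hP.ne_zero hδk hxl2 hel2
  have hzw3 : EdgeCol.offSwap c2 e δ x z w = b := (offSwap_eq_iff hbe hδb).2 hzw2
  have haw3 : a ∈ Miss k (EdgeCol.offSwap c2 e δ x) w :=
    (mem_Miss_offSwap_of_ne hae hδa).2 haw2
  have hyl3 : EdgeCol.offSwap c2 e δ x y l = β := (offSwap_eq_iff hβe hδβ.symm).2 hyl2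
  have hxz3 : EdgeCol.offSwap c2 e δ x x z = β := (offSwap_eq_iff hβe hδβ.symm).2 hxz2
  rw [← hX3] at hb1 ha1
  have hX3' : 2 ≤ #(Miss k (EdgeCol.offSwap c2 e δ x) x) :=
    Finset.one_lt_card.2 ⟨b, hb1, a, ha1, hba⟩
  clear hX3
  generalize EdgeCol.offSwap c2 e δ x = c3 at *
  have hβ0 := Miss.pos hz
  have hc4 : Col G k x y (EdgeCol.setEdge c3 y l δ) :=
    hc3.setEdge (by rw [hyl3]; exact hβ0) hyδ3 hlδ3
  have hM4 : ∀ {d v}, v ≠ y → v ≠ l →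
      (d ∈ Miss k (EdgeCol.setEdge c3 y l δ) v ↔ d ∈ Miss k c3 v) :=
    fun h h' => mem_Miss_setEdge_of_ne h h'
  have hX4 : Miss k (EdgeCol.setEdge c3 y l δ) x = Miss k c3 x := by
    ext d
    exact hM4 hxy hxl
  refine hc4.path hno (z := z) (w := w) (a := a) (by rwa [hX4]) ?_ ?_ hP.ne_right ?_
    ((hM4 hwy hlw.symm).2 haw3)
  · rw [setEdge_of_ne, hxz3, hc3.toProper.mem_Miss_setEdge hyl (by rw [hyl3]; exact hδβ.symm)]
    · exact ⟨hδβ.symm, Or.inr ⟨hyl3.symm, hβ0⟩⟩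
    · rw [ne_eq, Sym2.eq_iff]
      tauto
  · rw [hX4, setEdge_of_ne, hzw3]
    · exact Or.inl hb1
    · rw [ne_eq, Sym2.eq_iff]
      tauto
  · rwa [hX4]

lemma Pair.reachable_deleteEdges [Fintype V] (hP : Pair c x y z l w δ) (hno : Uncolorable G k)
    (hc : Col G k x y c) (hX : 2 ≤ #(Miss k c x)) (hz : c x z ∈ Miss k c y)
    (he : e ∈ Miss k c x) (hel : e ∈ Miss k c l) (he' : e' ∈ Miss k c x) (hel' : e' ∈ Miss k c l)
    (hee : e ≠ e') (ha : a ∈ Miss k c x) (haw : a ∈ Miss k c w) (hb : b ∈ Miss k c x)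
    (hae : a ≠ e) (hae' : a ≠ e') (hba : b ≠ a) (hbe : b ≠ e) (hbe' : b ≠ e') :
    ((kempe c b δ).deleteEdges {s(y, l)}).Reachable x z := by
  have hδ := hP.not_mem hno hc hX hz ha haw
  have hδe : δ ≠ e' := fun h => hδ (h ▸ he')
  have hδβ := hP.ne_of_mem hz
  have hyl : y ≠ l := hc.ne_of_ne_zero (by rw [hP.left]; exact hP.ne_zero)
  have hβ : ∀ {d}, d ∈ Miss k c x → d ≠ c x z := fun hd => (Miss.ne hd z).symm
  have hl := hc.kempe_three (Miss.pos he') (Miss.pos hz) hc.ne hP.ne_left.symm hyl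
    (Or.inl he') (Or.inr hz) (Or.inl hel') (hc.linked hno he' hz)
  have hc' := hc.offSwap (Miss.pos he') (Miss.le he') (Miss.pos hz) (Miss.le hz) x
  have hX' : Miss k (EdgeCol.offSwap c e' (c x z) x) x = Miss k c x := Miss_offSwap_self
  have hxz : EdgeCol.offSwap c e' (c x z) x x z = c x z := offSwap_self
  have key := (hP.offSwap hδe hδβ).reachable_setEdge hno hc' (by rwa [hX'])
    (hc.fan_keep hno hz he') (e := e) (a := a) (b := b)
    (by rw [hxz]; exact mem_Miss_offSwap_right (Miss.pos hz) (Miss.le hz) hl hel')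
    (by rwa [hX']) ((mem_Miss_offSwap_of_ne hee (hβ he)).2 hel) (by rwa [hX'])
    ((mem_Miss_offSwap_of_ne hae' (hβ ha)).2 haw) (by rwa [hX']) hae hba hbe
  refine key.mono fun u v huv => ?_
  rw [hxz] at huv
  have hp : Proper k (EdgeCol.setEdge (EdgeCol.offSwap c e' (c x z) x) y l (c x z)) := by
    refine hc'.toProper.setEdge hyl (Miss.le hz) (Or.inr ⟨?_, ?_⟩)
    · exact hc.Miss_offSwap_keep hno he' hz
    · exact mem_Miss_offSwap_right (Miss.pos hz) (Miss.le hz) hl hel'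
  rw [hp.kempe_adj (Miss.pos hb) hP.ne_zero] at huv
  rw [SimpleGraph.deleteEdges_adj, hc.kempe_adj (Miss.pos hb) hP.ne_zero, Set.mem_singleton_iff]
  by_cases h : s(u, v) = s(y, l)
  · rw [EdgeCol.setEdge, if_pos h] at huv
    rcases huv with h' | h'
    · exact absurd h'.symm (hβ hb)
    · exact absurd h'.symm hδβ
  · rw [setEdge_of_ne h, offSwap_eq_iff hbe' (hβ hb), offSwap_eq_iff hδe hδβ] at huv
    exact ⟨huv, h⟩

lemma Pair.false_of_mem [Fintype V] (hP : Pair c x y z l w δ) (hno : Uncolorable G k)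
    (hc : Col G k x y c) (hX : 5 ≤ #(Miss k c x)) (hz : c x z ∈ Miss k c y)
    (he : e ∈ Miss k c x) (hel : e ∈ Miss k c l) (he' : e' ∈ Miss k c x) (hel' : e' ∈ Miss k c l)
    (hee : e ≠ e') (ha : a ∈ Miss k c x) (haw : a ∈ Miss k c w) (ha' : a' ∈ Miss k c x)
    (haw' : a' ∈ Miss k c w) (haa : a ≠ a') : False := by
  have hX2 : 2 ≤ #(Miss k c x) := by omega
  have disj : ∀ {s t t'}, s ∈ Miss k c x → s ∈ Miss k c w → t ∈ Miss k c x → t ∈ Miss k c w →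
      s ≠ t → t' ∈ Miss k c x → t' ∈ Miss k c l → ∀ {r}, r ∈ Miss k c x → r ∈ Miss k c l →
      t' ≠ r → s ≠ t' := by
    rintro s t _ hs hsw ht htw hst - hsl r hr hrl hrs rfl
    exact hrs (hP.eq_of_mem hno hc hX2 hz hs hsw hsl ht htw hst.symm hr hrl).symm
  have h1 : a ≠ e := disj ha haw ha' haw' haa he hel he' hel' hee
  have h2 : a ≠ e' := disj ha haw ha' haw' haa he' hel' he hel hee.symm
  have h3 : a' ≠ e := disj ha' haw' ha haw haa.symm he hel he' hel' hee
  have h4 : a' ≠ e' := disj ha' haw' ha haw haa.symm he' hel' he hel hee.symm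
  obtain ⟨b, hb, hF⟩ := Finset.exists_mem_notMem_of_card_lt_card
    (s := {a, a', e, e'}) (t := Miss k c x) (Finset.card_le_four.trans_lt hX)
  simp only [mem_insert, mem_singleton, not_or] at hF
  obtain ⟨hba, hba', hbe, hbe'⟩ := hF
  have hδ := hP.not_mem hno hc hX2 hz ha haw
  have hδβ := hP.ne_of_mem hz
  have hyl : y ≠ l := hc.ne_of_ne_zero (by rw [hP.left]; exact hP.ne_zero)
  have hzw : z ≠ w := hc.ne_of_ne_zero (by rw [hP.right]; exact hP.ne_zero)
  have hwy : w ≠ y := by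
    rintro rfl
    exact hc.not_mem_Miss hno ha haw
  have hlz : l ≠ z := by
    rintro rfl
    exact hc.fan_left hno hz he hel
  have r1 := hP.reachable_deleteEdges hno hc hX2 hz he hel he' hel' hee ha haw hb h1 h2
    hba hbe hbe'
  have hP' : Pair (EdgeCol.shift c x y z) x z y w l δ :=
    { ne_zero := hP.ne_zero
      left := by rw [shift_of_ne_of_ne (hc.ne_left hz).symm hP.ne_right, hP.right]
      right := by rw [shift_of_ne_of_ne hc.ne.symm hP.ne_left, hP.left]
      ne_left := hP.ne_right
      ne_right := hP.ne_left }
  have hXs := hc.Miss_shift_left hz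
  have hMl : ∀ {d}, d ∈ Miss k c l → d ∈ Miss k (EdgeCol.shift c x y z) l :=
    fun h => (mem_Miss_shift_of_ne hP.ne_left hyl.symm hlz).2 h
  have hMw : ∀ {d}, d ∈ Miss k c w → d ∈ Miss k (EdgeCol.shift c x y z) w :=
    fun h => (mem_Miss_shift_of_ne hP.ne_right hwy hzw.symm).2 h
  have r2 := hP'.reachable_deleteEdges hno (hc.shift hz) (hXs.symm ▸ hX2)
    (by rw [shift_left]; exact (hc.mem_Miss_shift_new hz).2 (Or.inl rfl))
    (e := a) (e' := a') (a := e) (b := b) (hXs.symm ▸ ha) (hMw haw) (hXs.symm ▸ ha') (hMw haw')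
    haa (hXs.symm ▸ he) (hMl hel) (hXs.symm ▸ hb) h1.symm h3.symm hbe hba hba'
  rw [hc.kempe_shift hz (Miss.pos hb) hP.ne_zero (Miss.ne hb z) hδβ.symm] at r2
  have s1 := reachable_deleteEdges_or (z := z) (w := w) r1
  have s2 := reachable_deleteEdges_or (z := y) (w := l) r2
  rw [SimpleGraph.deleteEdges_deleteEdges] at s1 s2
  rw [Set.union_comm] at s2
  have hKle : (kempe c b δ).deleteEdges ({s(y, l)} ∪ {s(z, w)}) ≤ kempe c b δ :=
    SimpleGraph.deleteEdges_le _
  have hK : ∀ u v, ((kempe c b δ).deleteEdges ({s(y, l)} ∪ {s(z, w)})).Adj u v →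
      (c u v = b ∨ c u v = δ) ∧ s(u, v) ≠ s(y, l) ∧ s(u, v) ≠ s(z, w) := by
    intro u v h
    rw [SimpleGraph.deleteEdges_adj, hc.kempe_adj (Miss.pos hb) hP.ne_zero] at h
    simp only [Set.mem_union, Set.mem_singleton_iff, not_or] at h
    exact h
  generalize (kempe c b δ).deleteEdges ({s(y, l)} ∪ {s(z, w)}) = K at *
  have hmx : Mono K c x := ⟨δ, fun u h => (hK _ _ h).1.resolve_left (Miss.ne hb u)⟩
  have hm : ∀ {p q}, c p q = δ → (s(p, q) = s(y, l) ∨ s(p, q) = s(z, w)) → Mono K c p := by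
    intro p q hpq hs
    refine ⟨b, fun u h => (hK _ _ h).1.resolve_right fun h' => ?_⟩
    have : u = q := hc.inj p u q (by rw [h']; exact hP.ne_zero) (h'.trans hpq.symm)
    subst this
    have := hK _ _ h
    tauto
  have hmy : Mono K c y := hm hP.left (Or.inl rfl)
  have hml : Mono K c l := hm ((hc.symm _ _).trans hP.left) (Or.inl Sym2.eq_swap)
  have hmz : Mono K c z := hm hP.right (Or.inr rfl)
  have hmw : Mono K c w := hm ((hc.symm _ _).trans hP.right) (Or.inr Sym2.eq_swap)
  obtain ⟨p, hpd, hp, hmp, hxp⟩ : ∃ p, (p = z ∨ p = w) ∧ x ≠ p ∧ Mono K c p ∧ K.Reachable x p := by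
    rcases s1 with s | s | s
    · exact ⟨z, Or.inl rfl, hc.ne_left hz, hmz, s⟩
    · exact ⟨z, Or.inl rfl, hc.ne_left hz, hmz, s⟩
    · exact ⟨w, Or.inr rfl, hP.ne_right.symm, hmw, s⟩
  obtain ⟨q, hqd, hq, hmq, hxq⟩ : ∃ q, (q = y ∨ q = l) ∧ x ≠ q ∧ Mono K c q ∧ K.Reachable x q := by
    rcases s2 with s | s | s
    · exact ⟨y, Or.inl rfl, hc.ne, hmy, s⟩
    · exact ⟨y, Or.inl rfl, hc.ne, hmy, s⟩
    · exact ⟨l, Or.inr rfl, hP.ne_left.symm, hml, s⟩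
  refine hc.toProper.three (Miss.pos hb) hP.ne_zero hKle hp hq ?_ hmx hmp hmq hxp hxq
  have := hc.ne_of_mem hz
  have := (hP.ne hc hz).symm
  rcases hpd with rfl | rfl <;> rcases hqd with rfl | rfl
  · assumption
  · exact hlz.symm
  · exact hwy
  · assumption

end Pairs

end EdgeCol

namespace EdgeCol

section ThreePairs

variable {G : SimpleGraph V} {k : ℕ} {c : V → V → ℕ} {a b d e β γ μ δ : ℕ}
  {x y z u v w l t : V}

lemma mem_Miss_offSwap_iff_swap (ha : a ≠ 0) (hak : a ≤ k) (hb : b ≠ 0) (hbk : b ≤ k)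
    (h : ¬ (kempe c a b).Reachable x u) :
    d ∈ Miss k (offSwap c a b x) u ↔ Equiv.swap a b d ∈ Miss k c u := by
  have e : ∀ v, offSwap c a b x u v = d ↔ c u v = Equiv.swap a b d := by
    intro v
    rw [offSwap_of_not_reachable h, ← Equiv.eq_symm_apply, Equiv.symm_swap]
  have hr : (1 ≤ d ∧ d ≤ k) ↔ (1 ≤ Equiv.swap a b d ∧ Equiv.swap a b d ≤ k) := by
    rw [Equiv.swap_apply_def]
    split_ifs <;> omega
  simp only [mem_Miss, ne_eq, e, hr]

lemma card_Miss_offSwap_inter (ha : a ≠ 0) (hak : a ≤ k) (hb : b ≠ 0) (hbk : b ≤ k)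
    {M : Finset ℕ} (haM : a ∈ M) (hbM : b ∈ M) :
    #(Miss k (offSwap c a b x) u ∩ M) = #(Miss k c u ∩ M) := by
  by_cases h : (kempe c a b).Reachable x u
  · rw [Miss_offSwap_of_reachable h]
  · have : Miss k (offSwap c a b x) u ∩ M = (Miss k c u ∩ M).image (Equiv.swap a b) := by
      ext d
      have hM : d ∈ M ↔ Equiv.swap a b d ∈ M := by
        rw [Equiv.swap_apply_def]
        split_ifs with h1 h2
        · subst h1; exact iff_of_true haM hbM
        · subst h2; exact iff_of_true hbM haM
        · rfl
      rw [mem_inter, mem_Miss_offSwap_iff_swap ha hak hb hbk h, hM, ← mem_inter, mem_image]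
      constructor
      · intro h
        exact ⟨_, h, Equiv.swap_apply_self a b d⟩
      · rintro ⟨f, hf, rfl⟩
        rwa [Equiv.swap_apply_self]
    rw [this, Finset.card_image_of_injective _ (Equiv.injective _)]

lemma Pair.false_of_card [Fintype V] (hP : Pair c x y z l w δ) (hno : Uncolorable G k)
    (hc : Col G k x y c) (hX : 6 ≤ #(Miss k c x)) (hz : c x z ∈ Miss k c y)
    (hl : 2 ≤ #(Miss k c l ∩ insert (c x z) (Miss k c x)))
    (hw : 2 ≤ #(Miss k c w ∩ insert (c x z) (Miss k c x))) : False := by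
  obtain ⟨a, ha, a', ha', haa⟩ := Finset.one_lt_card.1 hw
  obtain ⟨e, he, e', he', hee⟩ := Finset.one_lt_card.1 hl
  obtain ⟨μ, hμ, hF⟩ := Finset.exists_mem_notMem_of_card_lt_card
    (s := {a, a', e, e', δ}) (t := Miss k c x) (Finset.card_le_five.trans_lt hX)
  simp only [mem_insert, mem_singleton, not_or] at hF
  obtain ⟨h1, h2, h3, h4, h5⟩ := hF
  have hyl : y ≠ l := hc.ne_of_ne_zero (by rw [hP.left]; exact hP.ne_zero)
  have hwy : w ≠ y := by
    rintro rfl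
    have : ∀ {s}, s ∈ Miss k c w ∩ insert (c x z) (Miss k c x) → s = c x z := by
      intro s hs
      rw [mem_inter, mem_insert] at hs
      exact hs.2.resolve_right fun h => hc.not_mem_Miss hno h hs.1
    exact haa ((this ha).trans (this ha').symm)
  have hδβ := hP.ne_of_mem hz
  have hc' := hc.offSwap (Miss.pos hμ) (Miss.le hμ) (Miss.pos hz) (Miss.le hz) x
  have hX' : Miss k (EdgeCol.offSwap c μ (c x z) x) x = Miss k c x := Miss_offSwap_self
  have key : ∀ {s t}, t ≠ x → t ≠ y → μ ≠ s →
      s ∈ Miss k c t ∩ insert (c x z) (Miss k c x) →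
      (if s = c x z then μ else s) ∈ Miss k (EdgeCol.offSwap c μ (c x z) x) x ∧
      (if s = c x z then μ else s) ∈ Miss k (EdgeCol.offSwap c μ (c x z) x) t := by
    intro s t htx hty hs hst
    rw [mem_inter, mem_insert] at hst
    rw [hX']
    split_ifs with h
    · subst h
      exact ⟨hμ, mem_Miss_offSwap_left (Miss.pos hμ) (Miss.le hμ)
        (hc.kempe_three (Miss.pos hμ) (Miss.pos hz) hc.ne htx.symm hty.symm (Or.inl hμ)
          (Or.inr hz) (Or.inr hst.1) (hc.linked hno hμ hz)) hst.1⟩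
    · exact ⟨hst.2.resolve_left h, (mem_Miss_offSwap_of_ne hs.symm h).2 hst.1⟩
  have hinj : ∀ {s s'}, μ ≠ s → μ ≠ s' → s ≠ s' →
      (if s = c x z then μ else s) ≠ (if s' = c x z then μ else s') := by
    intro s s' hs hs' hss
    split_ifs with h h'
    · exact absurd (h.trans h'.symm) hss
    · exact hs'
    · exact hs.symm
    · exact hss
  have ka := key hP.ne_right hwy h1 ha
  have ka' := key hP.ne_right hwy h2 ha'
  have ke := key hP.ne_left hyl.symm h3 he
  have ke' := key hP.ne_left hyl.symm h4 he'
  exact (hP.offSwap (Ne.symm h5) hδβ).false_of_mem hno hc' (by rw [hX']; omega)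
    (hc.fan_keep hno hz hμ) ke.1 ke.2 ke'.1 ke'.2 (hinj h3 h4 hee) ka.1 ka.2 ka'.1 ka'.2
    (hinj h1 h2 haa)

/-- Three equally colored pairs of edges at `y` and `z`, where `X` is the set of colors missing
at `x`, and `T` contains many of the ends of these edges. -/
structure Triple (G : SimpleGraph V) [Fintype V] (k : ℕ) (x y z : V) (l w : Fin 3 → V)
    (δ : Fin 3 → ℕ) (T : Finset V) (X : Finset ℕ) (β : ℕ) (c : V → V → ℕ) : Prop where
  col : Col G k x y c
  miss : Miss k c x = X
  eq : c x z = β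
  mem : β ∈ Miss k c y
  pair : ∀ i, Pair c x y z (l i) (w i) (δ i)
  notMem : ∀ i, δ i ∉ X
  low : ∀ t ∈ T, Low G k x t
  card_le : #T ≤ 4
  cover : ∀ u, ∃ i, l i ∈ T ∧ w i ∈ T ∧ l i ≠ u ∧ w i ≠ u
  six_le : 6 ≤ #X

variable {l w : Fin 3 → V} {δ : Fin 3 → ℕ} {T : Finset V} {X : Finset ℕ}

lemma Triple.offSwap [Fintype V] (hno : Uncolorable G k) (h : Triple G k x y z l w δ T X β c)
    (ha : a ∈ X) (hb : b ≠ 0) (hbk : b ≤ k) (hδ : ∀ i, δ i ≠ b) :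
    Triple G k x y z l w δ T X β (offSwap c a b x) := by
  have ha' : a ∈ Miss k c x := by rwa [h.miss]
  exact
  { col := h.col.offSwap (Miss.pos ha') (Miss.le ha') hb hbk x
    miss := Miss_offSwap_self.trans h.miss
    eq := offSwap_self.trans h.eq
    mem := h.col.Miss_offSwap_keep hno ha' h.mem
    pair i := (h.pair i).offSwap (fun e => h.notMem i (e ▸ ha)) (hδ i)
    notMem := h.notMem
    low := h.low
    card_le := h.card_le
    cover := h.cover
    six_le := h.six_le }

/-- The number of colors of `M` missing at vertices of `T`, where each vertex counts for at most
two colors. -/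
noncomputable def potential (k : ℕ) (c : V → V → ℕ) (T : Finset V) (M : Finset ℕ) : ℕ :=
  ∑ t ∈ T, min 2 #(Miss k c t ∩ M)

lemma potential_lt_of_free {M : Finset ℕ} (hμM : μ ∈ M)
    (hγM : γ ∉ M) (hμ0 : μ ≠ 0) (hμk : μ ≤ k) (huT : u ∈ T)
    (hfree : ∀ t ∈ T, #(Miss k c t ∩ M) ≤ 2 → μ ∉ Miss k c t)
    (hu : #(Miss k c u ∩ M) ≤ 1) (hγ : γ ∈ Miss k c u)
    (hr : ¬ (kempe c μ γ).Reachable x u) :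
    potential k c T M < potential k (offSwap c μ γ x) T M := by
  have hsub : ∀ t, (Miss k c t ∩ M).erase μ ⊆ Miss k (offSwap c μ γ x) t ∩ M := by
    intro t d hd
    rw [mem_erase, mem_inter] at hd
    have hdγ : d ≠ γ := by
      rintro rfl
      exact hγM hd.2.2
    rw [mem_inter, mem_Miss_offSwap_of_ne hd.1 hdγ]
    exact hd.2
  refine Finset.sum_lt_sum (fun t ht => ?_) ⟨u, huT, ?_⟩
  · have h1 := Finset.card_le_card (hsub t)
    by_cases h : #(Miss k c t ∩ M) ≤ 2
    · rw [Finset.erase_eq_of_notMem fun h' => hfree t ht h (mem_inter.1 h').1] at h1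
      omega
    · have := Finset.pred_card_le_card_erase (s := Miss k c t ∩ M) (a := μ)
      omega
  · have h1 : μ ∉ Miss k c u ∩ M := fun h' => hfree u huT (by omega) (mem_inter.1 h').1
    have h2 : insert μ (Miss k c u ∩ M) ⊆ Miss k (offSwap c μ γ x) u ∩ M := by
      refine Finset.insert_subset (mem_inter.2 ⟨mem_Miss_offSwap_left hμ0 hμk hr hγ, hμM⟩) ?_
      have := hsub u
      rwa [Finset.erase_eq_of_notMem h1] at this
    have h3 := Finset.card_le_card h2
    rw [Finset.card_insert_of_notMem h1] at h3
    omega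

lemma Triple.exists_of_free [Fintype V] (hno : Uncolorable G k)
    (h : Triple G k x y z l w δ T X β c) {u u' : V} (huT : u ∈ T) (huT' : u' ∈ T) (hne : u ≠ u')
    (hu : #(Miss k c u ∩ insert β X) ≤ 1) (hu' : #(Miss k c u' ∩ insert β X) ≤ 1) (hμ : μ ∈ X)
    (hfree : ∀ t ∈ T, #(Miss k c t ∩ insert β X) ≤ 2 → μ ∉ Miss k c t) :
    ∃ c', Triple G k x y z l w δ T X β c' ∧
      potential k c T (insert β X) < potential k c' T (insert β X) := by
  have hμ' : μ ∈ Miss k c x := by rwa [h.miss]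
  have hcard := h.col.card_Miss_left
  rw [h.miss] at hcard
  have hXM : #X ≤ #(insert β X) := Finset.card_le_card (Finset.subset_insert _ _)
  have hF : #(univ.image δ) ≤ 3 := Finset.card_image_le
  obtain ⟨γ, h1, h2, h3, h4⟩ := h.col.exists_common (h.low u huT) (h.low u' huT')
    (S := insert β X) (F := univ.image δ)
    (Finset.insert_subset (Miss_subset _ _ _ h.mem) (h.miss ▸ Miss_subset _ _ _))
    (by omega) (by omega)
  have h5 : ∀ i, δ i ≠ γ := fun i e => h4 (mem_image.2 ⟨i, mem_univ _, e⟩)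
  refine ⟨_, h.offSwap hno hμ (Miss.pos h1) (Miss.le h1) h5, ?_⟩
  by_cases hr : (kempe c μ γ).Reachable x u
  · have hr' := h.col.kempe_three (Miss.pos hμ') (Miss.pos h1) (h.low u huT).ne.symm
      (h.low u' huT').ne.symm hne (Or.inl hμ') (Or.inr h1) (Or.inr h2) hr
    exact potential_lt_of_free (mem_insert_of_mem hμ) h3 (Miss.pos hμ') (Miss.le hμ') huT' hfree
      hu' h2 hr'
  · exact potential_lt_of_free (mem_insert_of_mem hμ) h3 (Miss.pos hμ') (Miss.le hμ') huT hfree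
      hu h1 hr

lemma Triple.exists_potential_lt [Fintype V] (hno : Uncolorable G k)
    (h : Triple G k x y z l w δ T X β c) :
    ∃ c', Triple G k x y z l w δ T X β c' ∧
      potential k c T (insert β X) < potential k c' T (insert β X) := by
  set M := insert β X with hM
  have hβX : β ∉ X := by
    rw [← h.miss, ← h.eq]
    exact fun h' => Miss.ne h' z rfl
  have hz : c x z ∈ Miss k c y := by rw [h.eq]; exact h.mem
  obtain ⟨u, huT, u', huT', hne, hu, hu'⟩ : ∃ u ∈ T, ∃ u' ∈ T, u ≠ u' ∧
      #(Miss k c u ∩ M) ≤ 1 ∧ #(Miss k c u' ∩ M) ≤ 1 := by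
    by_contra! hh
    have hfalse : ∀ i, ¬ (2 ≤ #(Miss k c (l i) ∩ M) ∧ 2 ≤ #(Miss k c (w i) ∩ M)) := by
      rintro i ⟨h1, h2⟩
      refine (h.pair i).false_of_card hno h.col (h.miss ▸ h.six_le) hz ?_ ?_ <;>
      rwa [h.miss, h.eq]
    by_cases hex : ∃ u ∈ T, #(Miss k c u ∩ M) ≤ 1
    · obtain ⟨u, huT, hu⟩ := hex
      obtain ⟨i, h1, h2, h3, h4⟩ := h.cover u
      exact hfalse i ⟨hh u huT _ h1 h3.symm hu, hh u huT _ h2 h4.symm hu⟩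
    · push Not at hex
      obtain ⟨i, h1, h2, -⟩ := h.cover x
      exact hfalse i ⟨hex _ h1, hex _ h2⟩
  let P := (T.filter fun t => #(Miss k c t ∩ M) ≤ 2).biUnion fun t => Miss k c t ∩ M
  have hP : #P ≤ 6 := by
    refine Finset.card_biUnion_le.trans ?_
    rw [Finset.sum_filter]
    have h1 : ∑ t ∈ T, ((if #(Miss k c t ∩ M) ≤ 2 then #(Miss k c t ∩ M) else 0) +
        ((if t = u then 1 else 0) + (if t = u' then 1 else 0))) ≤ ∑ t ∈ T, 2 := by
      refine Finset.sum_le_sum fun t _ => ?_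
      by_cases e : t = u
      · subst e; simp only [hne, if_true, if_false]; split_ifs <;> omega
      · by_cases e' : t = u'
        · subst e'; simp only [e, if_true, if_false]; split_ifs <;> omega
        · simp only [e, e', if_false]; split_ifs <;> omega
    rw [Finset.sum_add_distrib, Finset.sum_add_distrib, Finset.sum_ite_eq' T u,
      Finset.sum_ite_eq' T u', if_pos huT, if_pos huT', Finset.sum_const, smul_eq_mul] at h1
    have := h.card_le
    omega
  have hMc : #M = #X + 1 := Finset.card_insert_of_notMem hβX
  have h6 := h.six_le
  obtain ⟨μ, hμ, hμP⟩ := Finset.exists_mem_notMem_of_card_lt_card (s := P) (t := M) (by omega)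
  have hfree : ∀ t ∈ T, #(Miss k c t ∩ M) ≤ 2 → μ ∉ Miss k c t := fun t ht ht2 hm =>
    hμP (mem_biUnion.2 ⟨t, mem_filter.2 ⟨ht, ht2⟩, mem_inter.2 ⟨hm, hμ⟩⟩)
  by_cases hμX : μ ∈ X
  · exact h.exists_of_free hno huT huT' hne hu hu' hμX hfree
  obtain rfl : μ = β := (mem_insert.1 hμ).resolve_right hμX
  obtain ⟨e, he⟩ : X.Nonempty := Finset.card_pos.1 (by omega)
  have he' : e ∈ Miss k c x := by rwa [h.miss]
  have h' := h.offSwap hno he (Miss.pos h.mem) (Miss.le h.mem)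
    fun i => (h.pair i).ne_of_mem h.mem
  have hcount : ∀ t, #(Miss k (EdgeCol.offSwap c e μ x) t ∩ M) = #(Miss k c t ∩ M) := fun t =>
    card_Miss_offSwap_inter (Miss.pos he') (Miss.le he') (Miss.pos h.mem) (Miss.le h.mem)
      (mem_insert_of_mem he) hμ
  obtain ⟨c', hc', hlt⟩ := h'.exists_of_free hno huT huT' hne (by rwa [hcount]) (by rwa [hcount])
    he (by
      intro t ht ht2
      rw [hcount] at ht2
      have hβt := hfree t ht ht2
      by_cases hr : (kempe c e μ).Reachable x t
      · rw [Miss_offSwap_of_reachable hr]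
        intro het
        have hty : y ≠ t := by
          rintro rfl
          exact hβt h.mem
        exact h.col.kempe_three (Miss.pos he') (Miss.pos h.mem) h.col.ne (h.low t ht).ne.symm hty
          (Or.inl he') (Or.inr h.mem) (Or.inl het) (h.col.linked hno he' h.mem) hr
      · exact not_mem_Miss_offSwap_left (Miss.pos h.mem) (Miss.le h.mem) hr hβt)
  refine ⟨c', hc', lt_of_le_of_lt (le_of_eq ?_) hlt⟩
  exact Finset.sum_congr rfl fun t _ => by rw [hcount]

lemma Triple.false [Fintype V] (hno : Uncolorable G k)
    (h : Triple G k x y z l w δ T X β c) : False := by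
  have key : ∀ n, ∃ c', Triple G k x y z l w δ T X β c' ∧
      n ≤ potential k c' T (insert β X) := by
    intro n
    induction n with
    | zero => exact ⟨c, h, Nat.zero_le _⟩
    | succ n ih =>
      obtain ⟨c', h', hn⟩ := ih
      obtain ⟨c'', h'', hlt⟩ := h'.exists_potential_lt hno
      exact ⟨c'', h'', by omega⟩
  obtain ⟨c', h', hn⟩ := key 9
  have h1 : potential k c' T (insert β X) ≤ ∑ t ∈ T, 2 :=
    Finset.sum_le_sum fun t _ => min_le_left _ _
  rw [Finset.sum_const, smul_eq_mul] at h1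
  have := h.card_le
  omega

lemma exists_cover (hl : l.Injective) (hw : w.Injective) :
    ∃ T : Finset V, #T ≤ 4 ∧ (∀ t ∈ T, ∃ i, t = l i ∨ t = w i) ∧
      ∀ u, ∃ i, l i ∈ T ∧ w i ∈ T ∧ l i ≠ u ∧ w i ≠ u := by
  by_cases h : ∃ i j, l i ≠ w j ∧ w i ≠ l j ∧ i ≠ j
  · obtain ⟨i, j, h1, h2, h3⟩ := h
    have h4 : l i ≠ l j := fun e => h3 (hl e)
    have h5 : w i ≠ w j := fun e => h3 (hw e)
    refine ⟨{l i, w i, l j, w j}, Finset.card_le_four, ?_, fun u => ?_⟩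
    · intro t ht
      simp only [mem_insert, mem_singleton] at ht
      rcases ht with rfl | rfl | rfl | rfl
      exacts [⟨i, Or.inl rfl⟩, ⟨i, Or.inr rfl⟩, ⟨j, Or.inl rfl⟩, ⟨j, Or.inr rfl⟩]
    · by_cases hu : u = l i ∨ u = w i
      · refine ⟨j, by simp, by simp, ?_, ?_⟩ <;> rcases hu with rfl | rfl
        exacts [h4.symm, h2.symm, h1.symm, h5.symm]
      · push Not at hu
        exact ⟨i, by simp, by simp, hu.1.symm, hu.2.symm⟩
  · push Not at h
    have h01 := fun e => h 0 1 e
    have h02 := fun e => h 0 2 e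
    have h12 := fun e => h 1 2 e
    have l01 := hl.ne (show (0 : Fin 3) ≠ 1 by decide)
    have l02 := hl.ne (show (0 : Fin 3) ≠ 2 by decide)
    have l12 := hl.ne (show (1 : Fin 3) ≠ 2 by decide)
    have w01 := hw.ne (show (0 : Fin 3) ≠ 1 by decide)
    have w02 := hw.ne (show (0 : Fin 3) ≠ 2 by decide)
    have w12 := hw.ne (show (1 : Fin 3) ≠ 2 by decide)
    have i01 : (0 : Fin 3) ≠ 1 := by decide
    have i02 : (0 : Fin 3) ≠ 2 := by decide
    have i12 : (1 : Fin 3) ≠ 2 := by decide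
    have hT : (∀ i, l i ∈ ({w 0, w 1, w 2} : Finset V)) := by
      intro i
      fin_cases i <;> simp <;> grind
    have hT' : (∀ i, w i ∈ ({w 0, w 1, w 2} : Finset V)) := by
      intro i
      fin_cases i <;> simp
    refine ⟨{w 0, w 1, w 2}, Finset.card_le_three.trans (by norm_num), ?_, fun u => ?_⟩
    · intro t ht
      simp only [mem_insert, mem_singleton] at ht
      rcases ht with rfl | rfl | rfl
      exacts [⟨0, Or.inr rfl⟩, ⟨1, Or.inr rfl⟩, ⟨2, Or.inr rfl⟩]
    · by_contra! hu
      have u0 := hu 0 (hT 0) (hT' 0)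
      have u1 := hu 1 (hT 1) (hT' 1)
      have u2 := hu 2 (hT 2) (hT' 2)
      by_cases h0 : l 0 = u
      · exact w12 ((u1 fun e => l01 (h0.trans e.symm)).trans
          (u2 fun e => l02 (h0.trans e.symm)).symm)
      · by_cases h1 : l 1 = u
        · exact w02 ((u0 h0).trans (u2 fun e => l12 (h1.trans e.symm)).symm)
        · exact w01 ((u0 h0).trans (u1 h1).symm)

/-- There are no three pairs of equally colored edges at `y` and `z` with low ends. -/
lemma Col.not_three_pairs [Fintype V] (hno : Uncolorable G k) (hc : Col G k x y c)
    (hX : 6 ≤ #(Miss k c x)) (hz : c x z ∈ Miss k c y) (hδ : δ.Injective)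
    (hδX : ∀ i, δ i ∉ Miss k c x) (hP : ∀ i, Pair c x y z (l i) (w i) (δ i))
    (hl : ∀ i, Low G k x (l i)) (hw : ∀ i, Low G k x (w i)) : False := by
  obtain ⟨T, h1, h2, h3⟩ := exists_cover (l := l) (w := w)
    (fun i j e => hδ (by rw [← (hP i).left, ← (hP j).left, e]))
    (fun i j e => hδ (by rw [← (hP i).right, ← (hP j).right, e]))
  refine Triple.false hno (T := T) (X := Miss k c x) (β := c x z) (c := c) (l := l) (w := w)
    (δ := δ) ⟨hc, rfl, rfl, hz, hP, hδX, fun t ht => ?_, h1, h3, hX⟩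
  obtain ⟨i, rfl | rfl⟩ := h2 t ht
  exacts [hl i, hw i]

end ThreePairs

end EdgeCol

namespace EdgeCol

lemma Col.apply_ne_zero {G : SimpleGraph V} {k : ℕ} {c : V → V → ℕ} {x y l : V}
    (hc : Col G k x y c) (h : G.Adj y l) (hl : l ≠ x) : c y l ≠ 0 := by
  rw [hc.ne_zero_iff]
  refine ⟨h, fun e => ?_⟩
  rw [Sym2.eq_iff] at e
  have := hc.ne
  tauto

section Counting

variable [Fintype V] {G : SimpleGraph V} {k : ℕ} {c : V → V → ℕ} {β δ : ℕ} {x y z l : V}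
  {H : V → Prop}

/-- The neighbors of `y` other than `x` that satisfy `H`. -/
noncomputable def nbrs (G : SimpleGraph V) (H : V → Prop) (x y : V) : Finset V :=
  univ.filter fun z => G.Adj y z ∧ z ≠ x ∧ H z

lemma mem_nbrs : l ∈ nbrs G H x y ↔ G.Adj y l ∧ l ≠ x ∧ H l := by
  simp [nbrs]

lemma card_nbrs_add (h : G.Adj x y) :
    #(nbrs G H x y) + #(nbrs G (fun v => ¬ H v) x y) + 1 = G.degree y := by
  have h1 : (nbrs G H x y) ∪ (nbrs G (fun v => ¬ H v) x y) = (G.neighborFinset y).erase x := by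
    ext v
    simp only [mem_union, mem_nbrs, mem_erase, SimpleGraph.mem_neighborFinset]
    tauto
  have h2 : Disjoint (nbrs G H x y) (nbrs G (fun v => ¬ H v) x y) := by
    rw [Finset.disjoint_left]
    intro v hv hv'
    exact (mem_nbrs.1 hv').2.2 (mem_nbrs.1 hv).2.2
  have hx : x ∈ G.neighborFinset y := by simpa using h.symm
  rw [← Finset.card_union_of_disjoint h2, h1, Finset.card_erase_add_one hx,
    SimpleGraph.card_neighborFinset_eq_degree]

/-- The colors of the edges from `y` to vertices other than `x` not satisfying `H`. -/
noncomputable def lowColors (G : SimpleGraph V) (H : V → Prop) (c : V → V → ℕ) (x y : V) :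
    Finset ℕ :=
  (nbrs G (fun v => ¬ H v) x y).image (c y)

lemma Col.mem_lowColors (hc : Col G k x y c) (h : δ ∈ lowColors G H c x y) :
    ∃ l, c y l = δ ∧ δ ≠ 0 ∧ l ≠ x ∧ ¬ H l := by
  rw [lowColors, mem_image] at h
  obtain ⟨l, hl, rfl⟩ := h
  rw [mem_nbrs] at hl
  exact ⟨l, rfl, hc.apply_ne_zero hl.1 hl.2.1, hl.2⟩

lemma Col.card_lowColors (hc : Col G k x y c) :
    #(lowColors G H c x y) + #(nbrs G H x y) + 1 = G.degree y := by
  rw [lowColors, Finset.card_image_of_injOn, ← card_nbrs_add (H := H) hc.adj,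
    add_comm #(nbrs _ H _ _)]
  intro l hl l' _ e
  have hl := mem_nbrs.1 hl
  exact hc.inj y l l' (hc.apply_ne_zero hl.1 hl.2.1) e

lemma Col.disjoint_lowColors (hc : Col G k x y c) :
    Disjoint (Miss k c y) (lowColors G H c x y) := by
  rw [Finset.disjoint_right]
  intro δ h h'
  obtain ⟨l, hl, -⟩ := hc.mem_lowColors h
  exact Miss.ne h' l hl

lemma Col.le_card_nbrs (hno : Uncolorable G k) (hc : Col G k x y c) (hd : G.degree x + 5 ≤ k)
    (hlow : ∀ u, u ≠ x → ¬ H u → Low G k x u) (hz : c x z ∈ Miss k c y) :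
    2 * k ≤ #(nbrs G H x z) + G.degree x + #(nbrs G H x y) + 4 := by
  have hX := hc.card_Miss_left
  have hY := hc.card_Miss_right
  have hR := hc.card_lowColors (H := H)
  have hX6 : 6 ≤ #(Miss k c x) := by omega
  have hXne : (Miss k c x).Nonempty := Finset.card_pos.1 (by omega)
  set X := Miss k c x with hXd
  set Y := Miss k c y with hYd
  set R := lowColors G H c x y with hRd
  set I := (nbrs G H x z).image (c z) with hId
  let B₁ := (X ∪ Y).filter fun δ => ∃ w, w ≠ x ∧ ¬ H w ∧ c z w = δ
  let B₂ := R.filter fun δ => δ ∈ X ∨ δ ∈ Miss k c z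
  let B₃ := (R \ X).filter fun δ => ∃ w, w ≠ x ∧ ¬ H w ∧ c z w = δ
  have h1 : #B₁ ≤ 1 := by
    rw [Finset.card_le_one]
    intro δ hδ δ' hδ'
    simp only [B₁, mem_filter, mem_union] at hδ hδ'
    obtain ⟨hδ, w, hwx, hwH, hw⟩ := hδ
    obtain ⟨hδ', w', hwx', hwH', hw'⟩ := hδ'
    have := Stuck.unique hno hc (le_trans (by norm_num) hX6) hz (hlow w hwx hwH) (hlow w' hwx' hwH')
      (Or.inl ⟨hw, hδ⟩) (Or.inl ⟨hw', hδ'⟩)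
    rw [← hw, ← hw', this]
  have h2 : #B₂ ≤ 1 := by
    rw [Finset.card_le_one]
    intro δ hδ δ' hδ'
    simp only [B₂, mem_filter] at hδ hδ'
    obtain ⟨hδR, hδ⟩ := hδ
    obtain ⟨hδR', hδ'⟩ := hδ'
    obtain ⟨l, hl, -, hlx, hlH⟩ := hc.mem_lowColors hδR
    obtain ⟨l', hl', -, hlx', hlH'⟩ := hc.mem_lowColors hδR'
    have := Stuck.unique hno hc (le_trans (by norm_num) hX6) hz (hlow l hlx hlH) (hlow l' hlx' hlH')
      (Or.inr ⟨hl, hδ.symm⟩) (Or.inr ⟨hl', hδ'.symm⟩)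
    rw [← hl, ← hl', this]
  have h3 : #B₃ ≤ 2 := by
    by_contra hcon
    let δ := B₃.orderEmbOfCardLe (k := 3) (by omega)
    have hδ : ∀ i, δ i ∈ B₃ := fun i => Finset.orderEmbOfCardLe_mem _ _ _
    simp only [B₃, mem_filter, mem_sdiff] at hδ
    choose hδ w hwx hwH hw using hδ
    choose l hl hδ0 hlx hlH using fun i => hc.mem_lowColors (hδ i).1
    exact hc.not_three_pairs hno hX6 hz δ.injective (fun i => (hδ i).2)
      (fun i => ⟨hδ0 i, hl i, hw i, hlx i, hwx i⟩) (fun i => hlow _ (hlx i) (hlH i))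
      (fun i => hlow _ (hwx i) (hwH i))
  have hI : #I ≤ #(nbrs G H x z) := Finset.card_image_le
  have hcover : X ∪ Y ∪ R ⊆ {c x z} ∪ I ∪ B₁ ∪ (B₂ \ X) ∪ B₃ := by
    intro δ hδ
    simp only [mem_union, mem_singleton]
    by_contra! hcon
    obtain ⟨⟨⟨⟨n1, n2⟩, n3⟩, n4⟩, n5⟩ := hcon
    have hδ0 : δ ≠ 0 ∧ δ ≤ k := by
      rw [mem_union, mem_union] at hδ
      rcases hδ with (h | h) | h
      · exact ⟨Miss.pos h, Miss.le h⟩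
      · exact ⟨Miss.pos h, Miss.le h⟩
      · obtain ⟨l, rfl, h0, -⟩ := hc.mem_lowColors h
        exact ⟨h0, hc.le _ _⟩
    by_cases hδz : δ ∈ Miss k c z
    · have hX' : δ ∉ X := fun h => hc.fan_left hno hz h hδz
      have hY' : δ ∉ Y := fun h => hc.fan_right hno hz hXne h hδz
      have hR' : δ ∈ R := by
        simp only [mem_union] at hδ
        tauto
      exact n4 (mem_sdiff.2 ⟨mem_filter.2 ⟨hR', Or.inr hδz⟩, hX'⟩)
    · obtain ⟨w, hw⟩ := exists_of_not_mem_Miss hδ0.1 hδ0.2 hδz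
      have hwx : w ≠ x := by
        rintro rfl
        exact n1 (hw.symm.trans (hc.symm _ _))
      have hwH : ¬ H w := by
        intro hH
        refine n2 (mem_image.2 ⟨w, mem_nbrs.2 ⟨?_, hwx, hH⟩, hw⟩)
        exact ((hc.ne_zero_iff z w).1 (by omega)).1
      have hex : ∃ w, w ≠ x ∧ ¬ H w ∧ c z w = δ := ⟨w, hwx, hwH, hw⟩
      rw [mem_union] at hδ
      rcases hδ with h | h
      · exact n3 (mem_filter.2 ⟨h, hex⟩)
      · by_cases hδX : δ ∈ X
        · exact n3 (mem_filter.2 ⟨mem_union_left _ hδX, hex⟩)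
        · exact n5 (mem_filter.2 ⟨mem_sdiff.2 ⟨h, hδX⟩, hex⟩)
  have hle := Finset.card_le_card hcover
  have u1 := Finset.card_union_le ({c x z} ∪ I ∪ B₁ ∪ (B₂ \ X)) B₃
  have u2 := Finset.card_union_le ({c x z} ∪ I ∪ B₁) (B₂ \ X)
  have u3 := Finset.card_union_le ({c x z} ∪ I) B₁
  have u4 := Finset.card_union_le {c x z} I
  have hXY : Disjoint X Y := Finset.disjoint_left.2 fun a ha => hc.not_mem_Miss hno ha
  have v1 := Finset.card_union_of_disjoint hXY
  have v2 := Finset.card_union_add_card_inter (X ∪ Y) R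
  have v3 : (X ∪ Y) ∩ R ⊆ B₂ ∩ X := by
    intro δ hδ
    simp only [mem_inter, mem_union] at hδ
    have hX' : δ ∈ X := hδ.1.resolve_right fun h =>
      Finset.disjoint_left.1 hc.disjoint_lowColors h hδ.2
    exact mem_inter.2 ⟨mem_filter.2 ⟨hδ.2, Or.inl hX'⟩, hX'⟩
  have v4 := Finset.card_le_card v3
  have v5 := Finset.card_sdiff_add_card_inter B₂ X
  rw [Finset.card_singleton] at u4
  omega

/-- The color `δ` can be made missing at `y` without changing the colors at `x`. -/
def Freeable (G : SimpleGraph V) (k : ℕ) (x y : V) (c : V → V → ℕ) (δ : ℕ) : Prop :=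
  ∃ c', Col G k x y c' ∧ (∀ v, c' x v = c x v) ∧ δ ∈ Miss k c' y

lemma Col.freeable_of_mem {e : ℕ} (hno : Uncolorable G k) (hc : Col G k x y c)
    (hβ : β ∈ Miss k c y) (he : e ∈ Miss k c x) (hel : e ∈ Miss k c l) (hlx : l ≠ x)
    (hδ0 : c y l ≠ 0) (hδX : c y l ∉ Miss k c x) : Freeable G k x y c (c y l) := by
  have hyl : y ≠ l := hc.ne_of_ne_zero hδ0
  have hδe : c y l ≠ e := fun h => hδX (h ▸ he)
  have hδβ : c y l ≠ β := Miss.ne hβ l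
  have hr := hc.kempe_three (Miss.pos he) (Miss.pos hβ) hc.ne hlx.symm hyl (Or.inl he)
    (Or.inr hβ) (Or.inl hel) (hc.linked hno he hβ)
  have hc' := hc.offSwap (Miss.pos he) (Miss.le he) (Miss.pos hβ) (Miss.le hβ) x
  have hyl' : EdgeCol.offSwap c e β x y l = c y l := (offSwap_eq_iff hδe hδβ).2 rfl
  have hβl : β ∈ Miss k (EdgeCol.offSwap c e β x) l :=
    mem_Miss_offSwap_right (Miss.pos hβ) (Miss.le hβ) hr hel
  refine ⟨_, hc'.setEdge (by rwa [hyl']) (hc.Miss_offSwap_keep hno he hβ) hβl, fun v => ?_, ?_⟩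
  · rw [setEdge_of_ne, offSwap_self]
    have := hc.ne
    rw [ne_eq, Sym2.eq_iff]
    tauto
  · rw [hc'.toProper.mem_Miss_setEdge hyl (by rwa [hyl'])]
    exact ⟨hδβ, Or.inr ⟨hyl'.symm, hδ0⟩⟩

lemma Col.card_freeable_ge (hno : Uncolorable G k) (hc : Col G k x y c)
    (hd : G.degree x + 5 ≤ k) (hy : G.degree y ≤ k)
    (hlow : ∀ u, u ≠ x → ¬ H u → Low G k x u) :
    k ≤ #((Icc 1 k).filter fun δ => δ ∉ Miss k c x ∧ Freeable G k x y c δ) +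
      #(nbrs G H x y) + 2 := by
  have hX := hc.card_Miss_left
  have hY := hc.card_Miss_right
  have hR := hc.card_lowColors (H := H)
  have hX6 : 6 ≤ #(Miss k c x) := by omega
  obtain ⟨β, hβ⟩ : (Miss k c y).Nonempty := Finset.card_pos.1 (by omega)
  obtain ⟨z, hz⟩ := exists_of_not_mem_Miss (v := x) (Miss.pos hβ) (Miss.le hβ)
    fun h => hc.not_mem_Miss hno h hβ
  obtain ⟨e, he⟩ : (Miss k c x).Nonempty := Finset.card_pos.1 (by omega)
  set X := Miss k c x with hXd
  set Y := Miss k c y with hYd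
  set R := lowColors G H c x y with hRd
  have h1 : #(R ∩ X) ≤ 1 := by
    rw [Finset.card_le_one]
    intro δ hδ δ' hδ'
    rw [mem_inter] at hδ hδ'
    obtain ⟨l, hl, -, hlx, hlH⟩ := hc.mem_lowColors hδ.1
    obtain ⟨l', hl', -, hlx', hlH'⟩ := hc.mem_lowColors hδ'.1
    have := Stuck.unique (z := z) hno hc (le_trans (by norm_num) hX6) (hz ▸ hβ) (hlow l hlx hlH)
      (hlow l' hlx' hlH') (Or.inr ⟨hl, Or.inr hδ.2⟩) (Or.inr ⟨hl', Or.inr hδ'.2⟩)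
    rw [← hl, ← hl', this]
  have h2 : #((R \ X).filter fun δ => ¬ Freeable G k x y c δ) ≤ 1 := by
    rw [Finset.card_le_one]
    intro δ hδ δ' hδ'
    rw [mem_filter, mem_sdiff] at hδ hδ'
    obtain ⟨⟨hδR, hδX⟩, hδF⟩ := hδ
    obtain ⟨⟨hδR', hδX'⟩, hδF'⟩ := hδ'
    obtain ⟨l, rfl, hδ0, hlx, hlH⟩ := hc.mem_lowColors hδR
    obtain ⟨l', rfl, hδ0', hlx', hlH'⟩ := hc.mem_lowColors hδR'
    by_contra hne
    have hll : l ≠ l' := fun h => hne (by rw [h])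
    have hdisj : ∀ {m}, m ≠ x → c y m ≠ 0 → c y m ∉ X → ¬ Freeable G k x y c (c y m) →
        Miss k c m ∩ X = ∅ := by
      intro m hm h0 hmX hF
      rw [← Finset.disjoint_iff_inter_eq_empty, Finset.disjoint_left]
      exact fun a ha ha' => hF (hc.freeable_of_mem hno hβ ha' ha hm h0 hmX)
    have e1 := hdisj hlx hδ0 hδX hδF
    have e2 := hdisj hlx' hδ0' hδX' hδF'
    obtain ⟨γ, g1, g2, -, g4⟩ := hc.exists_common (hlow l hlx hlH) (hlow l' hlx' hlH')
      (S := X) (F := {c y l, c y l'}) (Miss_subset _ _ _) (by omega)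
      (by
        rw [e1, e2]
        have := Finset.card_le_two (a := c y l) (b := c y l')
        simp only [Finset.card_empty]
        omega)
    simp only [mem_insert, mem_singleton, not_or] at g4
    have hc' := hc.offSwap (Miss.pos he) (Miss.le he) (Miss.pos g1) (Miss.le g1) x
    have hkey : ∀ {m}, m ≠ x → c y m ≠ 0 → c y m ∉ X → γ ≠ c y m → γ ∈ Miss k c m →
        ¬ (kempe c e γ).Reachable x m → Freeable G k x y c (c y m) := by
      intro m hm h0 hmX hγ hγm hr
      have em : EdgeCol.offSwap c e γ x y m = c y m :=
        (offSwap_eq_iff (fun h => hmX (by rw [h]; exact he)) hγ.symm).2 rfl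
      obtain ⟨c'', k1, k2, k3⟩ := hc'.freeable_of_mem (l := m) (e := e) (β := β) hno
        (hc.Miss_offSwap_keep hno he hβ) (by rwa [Miss_offSwap_self])
        (mem_Miss_offSwap_left (Miss.pos he) (Miss.le he) hr hγm) hm (by rwa [em])
        (by rwa [em, Miss_offSwap_self])
      exact ⟨c'', k1, fun v => (k2 v).trans offSwap_self, em ▸ k3⟩
    by_cases hr : (kempe c e γ).Reachable x l
    · exact hδF' (hkey hlx' hδ0' hδX' g4.2 g2 (hc.kempe_three (Miss.pos he) (Miss.pos g1)
        hlx.symm hlx'.symm hll (Or.inl he) (Or.inr g1) (Or.inr g2) hr))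
    · exact hδF (hkey hlx hδ0 hδX g4.1 g1 hr)
  have hcover : Y ∪ R ⊆ ((Icc 1 k).filter fun δ => δ ∉ X ∧ Freeable G k x y c δ) ∪ (R ∩ X) ∪
      ((R \ X).filter fun δ => ¬ Freeable G k x y c δ) := by
    intro δ hδ
    simp only [mem_union, mem_filter, mem_inter, mem_sdiff]
    rw [mem_union] at hδ
    rcases hδ with h | h
    · exact Or.inl (Or.inl ⟨Miss_subset _ _ _ h, fun h' => hc.not_mem_Miss hno h' h,
        c, hc, fun _ => rfl, h⟩)
    · have : δ ∈ Icc 1 k := by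
        obtain ⟨l, rfl, h0, -⟩ := hc.mem_lowColors h
        rw [mem_Icc]
        exact ⟨by omega, hc.le _ _⟩
      tauto
  have hle := Finset.card_le_card hcover
  have u1 := Finset.card_union_le
    (((Icc 1 k).filter fun δ => δ ∉ X ∧ Freeable G k x y c δ) ∪ (R ∩ X))
    ((R \ X).filter fun δ => ¬ Freeable G k x y c δ)
  have u2 := Finset.card_union_le
    ((Icc 1 k).filter fun δ => δ ∉ X ∧ Freeable G k x y c δ) (R ∩ X)
  have v1 : #(Y ∪ R) = #Y + #R := Finset.card_union_of_disjoint hc.disjoint_lowColors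
  omega

/-- `x` has at least `k - σ - 2` neighbors `z ≠ y` such that `z` has at least
`2 k - d(x) - σ - 4` neighbors satisfying `H` other than `x`, where `σ` is the number of neighbors
of `y` satisfying `H` other than `x`. -/
lemma Col.card_neighbors_ge (hno : Uncolorable G k) (hc : Col G k x y c)
    (hd : G.degree x + 5 ≤ k) (hy : G.degree y ≤ k)
    (hlow : ∀ u, u ≠ x → ¬ H u → Low G k x u) :
    k ≤ #(univ.filter fun z => G.Adj x z ∧ z ≠ y ∧
      2 * k ≤ #(nbrs G H x z) + G.degree x + #(nbrs G H x y) + 4) + #(nbrs G H x y) + 2 := by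
  refine (hc.card_freeable_ge hno hd hy hlow).trans ?_
  gcongr
  refine (Finset.card_le_card ?_).trans (Finset.card_image_le (f := c x))
  intro δ hδ
  rw [mem_filter, mem_Icc] at hδ
  obtain ⟨hδk, hδX, c', hc', hcc, hδY⟩ := hδ
  obtain ⟨z, hz⟩ := exists_of_not_mem_Miss (by omega) hδk.2 hδX
  rw [mem_image]
  refine ⟨z, ?_, hz⟩
  rw [mem_filter]
  refine ⟨mem_univ _, ((hc.ne_zero_iff x z).1 (by omega)).1, ?_, ?_⟩
  · rintro rfl
    rw [hc.eq_zero] at hz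
    omega
  · refine hc'.le_card_nbrs hno hd hlow (z := z) ?_
    rwa [hcc, hz]

end Counting

end EdgeCol

namespace EdgeCol

section Critical

variable {G : SimpleGraph V} {k : ℕ} {x y : V}

lemma uncolorable_of_not_exists (h : ¬ ∃ φ, IsProperEdgeColoring G k φ) : Uncolorable G k := by
  intro c hc hcG
  refine h ⟨Sym2.lift ⟨c, hc.symm⟩, ?_, ?_⟩
  · intro e
    induction e with | _ u v =>
    intro he
    rw [SimpleGraph.mem_edgeSet, ← hcG] at he
    rw [Sym2.lift_mk, mem_Icc]
    exact ⟨Nat.pos_of_ne_zero he, hc.le u v⟩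
  · rintro e he f hf hef ⟨v, hve, hvf⟩ hφ
    obtain ⟨u, rfl⟩ := Sym2.mem_iff_exists.1 hve
    obtain ⟨w, rfl⟩ := Sym2.mem_iff_exists.1 hvf
    rw [SimpleGraph.mem_edgeSet, ← hcG] at he
    exact hef (by rw [hc.inj v u w he hφ])

lemma exists_col (hG : ∀ H : SimpleGraph V, H < G → ∃ φ, IsProperEdgeColoring H k φ)
    (h : G.Adj x y) : ∃ c, Col G k x y c := by
  have hadj : ∀ u v, (G.deleteEdges {s(x, y)}).Adj u v ↔ G.Adj u v ∧ s(u, v) ≠ s(x, y) := by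
    intro u v
    rw [SimpleGraph.deleteEdges_adj, Set.mem_singleton_iff]
  obtain ⟨φ, h1, h2⟩ := hG (G.deleteEdges {s(x, y)})
    (lt_of_le_not_ge (SimpleGraph.deleteEdges_le _) fun hle => ((hadj x y).1 (hle h)).2 rfl)
  generalize G.deleteEdges {s(x, y)} = H at h1 h2 hadj
  have hpos : ∀ u v, H.Adj u v → 1 ≤ φ s(u, v) ∧ φ s(u, v) ≤ k := fun u v huv =>
    mem_Icc.1 (h1 s(u, v) huv)
  have hne : ∀ u v, (if H.Adj u v then φ s(u, v) else 0) ≠ 0 ↔ H.Adj u v := by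
    intro u v
    split_ifs with huv
    · have := hpos u v huv
      simp only [huv, iff_true]
      omega
    · simp [huv]
  refine ⟨fun u v => if H.Adj u v then φ s(u, v) else 0,
    { symm := ?_, le := ?_, diag := ?_, inj := ?_, adj := h, ne_zero_iff := ?_ }⟩
  · intro u v
    simp only [H.adj_comm u v, Sym2.eq_swap (a := u)]
  · intro u v
    split_ifs with huv
    · exact (hpos u v huv).2
    · exact Nat.zero_le _
  · intro u
    simp
  · intro u v w huv he
    have huw := huv
    rw [he] at huw
    have huv' := (hne u v).1 huv
    have huw' := (hne u w).1 huw
    rw [if_pos huv', if_pos huw'] at he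
    by_contra hvw
    refine h2 s(u, v) huv' s(u, w) huw' ?_ ⟨u, by simp, by simp⟩ he
    rwa [ne_eq, Sym2.congr_right]
  · intro u v
    rw [hne, hadj]

variable [Fintype V] {q : ℝ}

/-- In a critical graph, `x` has at least `Δ - σ - 2` neighbors `z ≠ y` with
`σ_q(x,z) ≥ 2 Δ - d(x) - σ - 4`, where `σ = σ_q(x,y)`. -/
lemma card_sigmaQ_ge {Δ : ℕ} (hG : EdgeCritical G Δ) (h : G.Adj x y)
    (hq1 : (Δ : ℝ) / 2 < q) (hq2 : q ≤ (Δ : ℝ) - (G.degree x : ℝ) / 2 - 2) :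
    Δ ≤ #(univ.filter fun z => G.Adj x z ∧ z ≠ y ∧
      2 * Δ ≤ sigmaQ G q x z + G.degree x + sigmaQ G q x y + 4) + sigmaQ G q x y + 2 := by
  obtain ⟨hΔ, hno, -, hsub⟩ := hG
  obtain ⟨c, hc⟩ := exists_col hsub h
  have hd : G.degree x + 5 ≤ Δ := by
    have : (G.degree x : ℝ) + 4 < Δ := by linarith
    exact_mod_cast this
  have hlow : ∀ u, u ≠ x → ¬ q ≤ (G.degree u : ℝ) → Low G Δ x u := by
    refine fun u hu hqu => ⟨hu, ?_⟩
    have : 2 * (G.degree u : ℝ) + G.degree x + 4 < 2 * Δ := by linarith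
    exact_mod_cast this
  exact hc.card_neighbors_ge (uncolorable_of_not_exists hno) hd
    (hΔ ▸ G.degree_le_maxDegree y) hlow

end Critical

end EdgeCol

theorem stmt10 (G : SimpleGraph V) [Fintype V] (Δ : ℕ) (hc : EdgeCritical G Δ)
    (x : V) (q : ℝ) (hq0 : 0 < q)
    (hq1 : (Δ : ℝ) / 2 < q) (hq2 : q ≤ (Δ : ℝ) - (G.degree x : ℝ) / 2 - 2)
    (hne : (G.neighborFinset x).Nonempty)
    (p : ℝ)
    (hp : p = min
      ((G.neighborFinset x).inf' hne
        (fun y => (sigmaQ G q x y : ℝ) - (Δ : ℝ) + (G.degree x : ℝ) - 1))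
      (((G.degree x / 2 : ℕ) : ℝ) - 3)) :
    (G.degree x : ℝ) - p - 3 ≤
      ((Finset.univ.filter (fun y => G.Adj x y ∧
        (Δ : ℝ) - p - 5 ≤ (sigmaQ G q x y : ℝ))).card : ℝ) := by
  obtain ⟨y, hy, hmin⟩ := Finset.exists_mem_eq_inf' hne
    (fun y => (sigmaQ G q x y : ℝ) - (Δ : ℝ) + (G.degree x : ℝ) - 1)
  have hle := fun z hz => Finset.inf'_le
    (fun y => (sigmaQ G q x y : ℝ) - (Δ : ℝ) + (G.degree x : ℝ) - 1) (b := z)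
    (s := G.neighborFinset x) hz
  rw [hmin] at hp
  simp only [hmin, SimpleGraph.mem_neighborFinset] at hle hy
  rcases le_or_gt ((sigmaQ G q x y : ℝ) - Δ + G.degree x - 1)
    (((G.degree x / 2 : ℕ) : ℝ) - 3) with h | h
  · rw [min_eq_left h] at hp
    have key := EdgeCol.card_sigmaQ_ge hc hy hq1 hq2
    have hsub : #(univ.filter fun z => G.Adj x z ∧ z ≠ y ∧
        2 * Δ ≤ sigmaQ G q x z + G.degree x + sigmaQ G q x y + 4) ≤
        #(univ.filter fun z => G.Adj x z ∧ (Δ : ℝ) - p - 5 ≤ (sigmaQ G q x z : ℝ)) := by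
      refine Finset.card_le_card (Finset.monotone_filter_right _ ?_)
      rintro z - ⟨hz, -, hσ⟩
      refine ⟨hz, ?_⟩
      have : 2 * (Δ : ℝ) ≤ sigmaQ G q x z + G.degree x + sigmaQ G q x y + 4 := by
        exact_mod_cast hσ
      linarith
    have : (Δ : ℝ) ≤ #(univ.filter fun z => G.Adj x z ∧
        (Δ : ℝ) - p - 5 ≤ (sigmaQ G q x z : ℝ)) + sigmaQ G q x y + 2 := by
      exact_mod_cast key.trans (by gcongr)
    linarith
  · rw [min_eq_right h.le] at hp
    have hint : ((G.degree x / 2 : ℕ) : ℝ) + Δ + 1 ≤ sigmaQ G q x y + G.degree x + 2 := by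
      have : ((G.degree x / 2 : ℕ) : ℝ) + Δ < sigmaQ G q x y + G.degree x + 2 := by linarith
      exact_mod_cast this
    have hfloor : (G.degree x : ℝ) ≤ 2 * ((G.degree x / 2 : ℕ) : ℝ) + 1 := by
      exact_mod_cast (by omega : G.degree x ≤ 2 * (G.degree x / 2) + 1)
    have hall : (univ.filter fun z => G.Adj x z ∧ (Δ : ℝ) - p - 5 ≤ (sigmaQ G q x z : ℝ)) =
        G.neighborFinset x := by
      ext z
      rw [mem_filter, SimpleGraph.mem_neighborFinset]
      refine ⟨fun hz => hz.2.1, fun hz => ⟨mem_univ _, hz, ?_⟩⟩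
      have := hle z hz
      linarith
    rw [hall, SimpleGraph.card_neighborFinset_eq_degree]
    linarith
end
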